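/- arXiv:1501.00329 — 6 statements merged into one kernel-verified Lean document; each statement's English description precedes it below -/
import Mathlib

section
/- (Property 1.) Let 0 ≤ p01 ≤ p11 ≤ 1, p10 = 1 − p11, p01 + p10 > 0, and e0 ∈ [0,1] with e0 ≤ p10/(p01 + p10); let p0(0) = e0 and p0(n+1) = p10 + p0(n)·(p11 − p01). Let B > 0 and let pnf : ℕ → [0,1] be nonincreasing. Define z(0) = 0 and z(n+1) = z(n) + (pnf(n)/B)·(p11 − p0(n)·(p11 − p01)). Then z is monotonically nondecreasing, and for all n ≥ m one has z(n+1) − z(m+1) ≤ z(n) − z(m); that is, the belief-state transition map τ sending z(n) to z(n+1) is monotonically increasing and contracting along the orbit {z(n)}. -/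
/-- An affine recursion `x (n+1) = a + x n * r` with `0 ≤ r` whose starting point lies below the
fixed point, i.e. `x 0 * (1 - r) ≤ a`, is nondecreasing. -/
theorem monotone_of_affine_recursion {a r : ℝ} (hr : 0 ≤ r) {x : ℕ → ℝ}
    (h0 : x 0 * (1 - r) ≤ a) (hrec : ∀ n, x (n + 1) = a + x n * r) : Monotone x := by
  have hfix : ∀ n, x n * (1 - r) ≤ a := by
    intro n
    induction n with
    | zero => exact h0
    | succ n ih =>
      rw [hrec]
      linarith [mul_le_mul_of_nonneg_left ih hr]
  refine monotone_nat_of_le_succ fun n => ?_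
  rw [hrec]
  linarith [hfix n]

/-- Property 1: the normalised expected battery level `z n` of a node that has been idle for
`n` slots is nondecreasing, and the belief-state transition map `τ` sending `z n` to `z (n+1)`
is a contracting map along the orbit, i.e. `z (n+1) - z (m+1) ≤ z n - z m` for `m ≤ n`.
Here `pnf n` is the (nonincreasing, `[0,1]`-valued) probability that the battery is not full
after `n` idle slots, `B > 0` is the battery capacity, and `p0 n` is the probability of the
non-harvesting state after `n` idle slots. -/
theorem belief_transition_monotone_contracting
    (p01 p11 e0 B : ℝ)
    (hp01 : 0 ≤ p01) (hp0111 : p01 ≤ p11) (hp11 : p11 ≤ 1)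
    (hpos : 0 < p01 + (1 - p11))
    (he00 : 0 ≤ e0) (he01 : e0 ≤ 1)
    (he0 : e0 ≤ (1 - p11) / (p01 + (1 - p11)))
    (hB : 0 < B)
    (pnf : ℕ → ℝ)
    (hpnf0 : ∀ n, 0 ≤ pnf n) (hpnf1 : ∀ n, pnf n ≤ 1) (hpnfanti : Antitone pnf)
    (p0 : ℕ → ℝ)
    (hp0init : p0 0 = e0)
    (hp0rec : ∀ n, p0 (n + 1) = (1 - p11) + p0 n * (p11 - p01))
    (z : ℕ → ℝ)
    (hz0 : z 0 = 0)
    (hzrec : ∀ n, z (n + 1) = z n + (pnf n / B) * (p11 - p0 n * (p11 - p01))) :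
    Monotone z ∧ ∀ m n, m ≤ n → z (n + 1) - z (m + 1) ≤ z n - z m := by
  have hr : 0 ≤ p11 - p01 := sub_nonneg.mpr hp0111
  have hp0mono : Monotone p0 := by
    refine monotone_of_affine_recursion hr ?_ hp0rec
    rw [hp0init]
    linarith [(le_div_iff₀ hpos).mp he0]
  have hp0le : ∀ n, p0 n ≤ 1 := by
    intro n
    induction n with
    | zero => exact hp0init.trans_le he01
    | succ n ih =>
      rw [hp0rec]
      linarith [mul_le_mul_of_nonneg_right ih hr]
  have hharvest : ∀ n, 0 ≤ p11 - p0 n * (p11 - p01) := fun n => by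
    linarith [mul_le_mul_of_nonneg_right (hp0le n) hr]
  refine ⟨monotone_nat_of_le_succ fun n => ?_, fun m n hmn => ?_⟩
  · rw [hzrec]
    exact le_add_of_nonneg_right (mul_nonneg (div_nonneg (hpnf0 n) hB.le) (hharvest n))
  · have hincr : pnf n / B * (p11 - p0 n * (p11 - p01)) ≤
        pnf m / B * (p11 - p0 m * (p11 - p01)) :=
      mul_le_mul (div_le_div_of_nonneg_right (hpnfanti hmn) hB.le)
        (sub_le_sub_left (mul_le_mul_of_nonneg_right (hp0mono hmn) hr) _)
        (hharvest n) (div_nonneg (hpnf0 m) hB.le)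
    rw [hzrec, hzrec]
    linarith
end

section
/- (Equation (8), symmetry of the pseudo value function.) Assume R is symmetric in its K arguments. For every 1 ≤ n ≤ T, every v ∈ [0,1]^N, and every pair of indices i, j with either both i, j ≤ K or both i, j > K, the pseudo value function satisfies W_n(v) = W_n(v ∘ (i j)), where v ∘ (i j) is v with coordinates i and j transposed. -/
/-- Sort the entries of a vector in decreasing order. -/
noncomputable def sortVec (N : ℕ) (v : Fin N → ℝ) : Fin N → ℝ :=
  fun i => ((List.ofFn v).mergeSort (fun a b => decide (b ≤ a))).getD i.val 0

/-- The first `K` entries of a vector of length `N` (for `K ≤ N`). -/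
noncomputable def firstK (N K : ℕ) (v : Fin N → ℝ) : Fin K → ℝ :=
  fun k => (List.ofFn v).getD k.val 0

/-- The set of scheduled indices `{1,…,K}` (the first `K` coordinates). -/
def sched (N K : ℕ) : Finset (Fin N) := Finset.univ.filter (fun i => i.val < K)

/-- The next belief vector `[T(v_Ē), 0(|E|)]`: the entries of `v` outside the active set `E`
are sorted in decreasing order, `τ` is applied to each, and `|E|` zeros are appended. -/
noncomputable def nextVec (N : ℕ) (τ : ℝ → ℝ) (E : Finset (Fin N)) (v : Fin N → ℝ) :
    Fin N → ℝ :=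
  fun i => (((((Finset.univ \ E).sort (· ≤ ·)).map v).mergeSort
      (fun a b => decide (b ≤ a))).map τ).getD i.val 0

/-- The pseudo value function, indexed by remaining time: `W … m v` is the pseudo value
function `W_n(v)` of the paper with `m = T - n` slots remaining after the current one;
`W … 0 v = R(v_1,…,v_K)` and
`W … (m+1) v = R(v_1,…,v_K) + β·Σ_{E ⊆ {1,…,K}} (1-p)^(K-|E|) p^|E| · W … m ([T(v_Ē), 0(|E|)])`. -/
noncomputable def W (N K : ℕ) (β p : ℝ) (τ : ℝ → ℝ) (R : (Fin K → ℝ) → ℝ) :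
    ℕ → (Fin N → ℝ) → ℝ
  | 0, v => R (firstK N K v)
  | m + 1, v => R (firstK N K v) +
      β * ∑ E ∈ (sched N K).powerset,
        ((1 - p) ^ (K - E.card) * p ^ E.card) * W N K β p τ R m (nextVec N τ E v)

/-- Reindexing a vector by a permutation amounts to moving the active set. -/
theorem nextVec_comp_perm (N : ℕ) (τ : ℝ → ℝ) (E : Finset (Fin N)) (v : Fin N → ℝ)
    (σ : Equiv.Perm (Fin N)) :
    nextVec N τ E (v ∘ σ) = nextVec N τ (E.map σ.toEmbedding) v := by
  have hperm : (((Finset.univ \ E).sort (· ≤ ·)).map (v ∘ σ)).Perm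
      (((Finset.univ \ E.map σ.toEmbedding).sort (· ≤ ·)).map v) := by
    have hE : Finset.univ \ E.map σ.toEmbedding = (Finset.univ \ E).map σ.toEmbedding := by
      ext x
      simp [Finset.mem_map_equiv]
    rw [← Multiset.coe_eq_coe, ← Multiset.map_coe, ← Multiset.map_coe, Finset.sort_eq,
      Finset.sort_eq, hE, Finset.map_val, Multiset.map_map]
    rfl
  have hsorted (l : List ℝ) : (l.mergeSort (fun a b => decide (b ≤ a))).Pairwise (· ≥ ·) := by
    refine (List.pairwise_mergeSort (le := fun a b : ℝ => decide (b ≤ a)) ?_ ?_ l).imp ?_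
    · intro a b c hab hbc
      simp only [decide_eq_true_eq] at *
      exact hbc.trans hab
    · intro a b
      simpa using le_total b a
    · intro a b h
      simpa using h
  have hsort := ((List.mergeSort_perm _ _).trans
    (hperm.trans (List.mergeSort_perm _ _).symm)).eq_of_pairwise
      (fun a b _ _ hab hba => le_antisymm hba hab) (hsorted _) (hsorted _)
  unfold nextVec
  rw [hsort]

/-- A permutation preserving the scheduled set acts on the first `K` entries by a
permutation. -/
theorem exists_perm_firstK_comp {N K : ℕ} (hKN : K ≤ N) (σ : Equiv.Perm (Fin N))
    (hσ : ∀ i, (σ i).val < K ↔ i.val < K) (v : Fin N → ℝ) :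
    ∃ ρ : Equiv.Perm (Fin K), firstK N K (v ∘ σ) = firstK N K v ∘ ρ := by
  let f : Fin K → Fin K := fun k => ⟨σ (k.castLE hKN), (hσ _).2 k.isLt⟩
  have hf : Function.Injective f := fun a b h =>
    Fin.castLE_injective hKN (σ.injective (Fin.ext (Fin.mk.inj h)))
  refine ⟨Equiv.ofBijective f (Finite.injective_iff_bijective.1 hf), funext fun k => ?_⟩
  have hfirst (w : Fin N → ℝ) (k : Fin K) : firstK N K w k = w (k.castLE hKN) := by
    have hk : k.val < N := k.isLt.trans_le hKN
    simp [firstK, List.getD_eq_getElem?_getD, hk, Fin.castLE]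
  rw [Function.comp_apply, hfirst, hfirst]
  rfl

/-- The pseudo value function is invariant under permutations preserving the scheduled set. -/
theorem W_comp_perm {N K : ℕ} (hKN : K ≤ N) (β p : ℝ) (τ : ℝ → ℝ) (R : (Fin K → ℝ) → ℝ)
    (hR : ∀ (σ : Equiv.Perm (Fin K)) (x : Fin K → ℝ), R (x ∘ σ) = R x)
    (σ : Equiv.Perm (Fin N)) (hσ : ∀ i, (σ i).val < K ↔ i.val < K) (m : ℕ) (v : Fin N → ℝ) :
    W N K β p τ R m (v ∘ σ) = W N K β p τ R m v := by
  obtain ⟨ρ, hρ⟩ := exists_perm_firstK_comp hKN σ hσ v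
  cases m with
  | zero => rw [W, W, hρ, hR]
  | succ m =>
    have hsum : (∑ E ∈ (sched N K).powerset, ((1 - p) ^ (K - E.card) * p ^ E.card) *
          W N K β p τ R m (nextVec N τ E (v ∘ σ))) =
        ∑ E ∈ (sched N K).powerset, ((1 - p) ^ (K - E.card) * p ^ E.card) *
          W N K β p τ R m (nextVec N τ E v) := by
      refine Finset.sum_equiv σ.finsetCongr (fun E => ?_) (fun E _ => ?_)
      · rw [Finset.mem_powerset, Finset.mem_powerset, Equiv.finsetCongr_apply,
          Finset.map_subset_iff_subset_preimage]
        simp [Finset.subset_iff, sched, hσ]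
      · rw [nextVec_comp_perm, Equiv.finsetCongr_apply, Finset.card_map]
    rw [W, W, hρ, hR, hsum]

/-- Equation (8): if the reward `R` is symmetric in its `K` arguments, then the pseudo value
function `W_n` is invariant under transposing two coordinates that are either both scheduled
(`i, j ≤ K`) or both unscheduled (`i, j > K`). -/
theorem pseudo_value_symmetric
    (N K T : ℕ) (hK : 1 ≤ K) (hKN : K ≤ N) (hT : 1 ≤ T)
    (β p : ℝ) (hβ0 : 0 < β) (hβ1 : β ≤ 1) (hp0 : 0 ≤ p) (hp1 : p ≤ 1)
    (τ : ℝ → ℝ) (R : (Fin K → ℝ) → ℝ)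
    (hRsym : ∀ (σ : Equiv.Perm (Fin K)) (x : Fin K → ℝ), R (x ∘ σ) = R x)
    (n : ℕ) (hn1 : 1 ≤ n) (hnT : n ≤ T)
    (v : Fin N → ℝ) (hv : ∀ i, v i ∈ Set.Icc (0 : ℝ) 1)
    (i j : Fin N)
    (hij : (i.val < K ∧ j.val < K) ∨ (K ≤ i.val ∧ K ≤ j.val)) :
    W N K β p τ R (T - n) v = W N K β p τ R (T - n) (v ∘ Equiv.swap i j) := by
  refine (W_comp_perm hKN β p τ R hRsym (Equiv.swap i j) (fun k => ?_) _ v).symm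
  rw [Equiv.swap_apply_def]
  split_ifs with hki hkj
  · subst hki
    omega
  · subst hkj
    omega
  · rfl
end

section
/- (Lemma 2.) Assume R : [0,1]^K → ℝ is regular (symmetric, nondecreasing in each argument, and decomposable) and bounded with constants Δ_l ≤ Δ_u, that τ is a monotonically increasing contracting map, and that β ≤ 1. Let x, x̃ ∈ [0,1]^N satisfy x_k = x̃_k for all k ≠ j and x_j ≥ x̃_j. Then for every 1 ≤ n ≤ T, W_n(sort(x)) − W_n(sort(x̃)) ≤ Δ_u·(x_j − x̃_j)·u(n), where sort(·) rearranges a vector in decreasing order and u(n) = Σ_{i=0}^{T−n} (β(1−p))^i. -/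
open Finset in
/-- Discrete product weights: under independent activity with probability `p`, each index of `S`
is inactive with probability `1 - p`. -/
theorem sum_powerset_weight_mul_sum_sdiff {ι : Type*} [Fintype ι] [DecidableEq ι] (S : Finset ι)
    (p : ℝ) (d : ι → ℝ) :
    ∑ E ∈ S.powerset, ((1 - p) ^ (#S - #E) * p ^ #E) * ∑ i ∈ univ \ E, d i =
      ∑ i, (if i ∈ S then 1 - p else 1) * d i := by
  have hswap : ∀ E : Finset ι, ∑ i ∈ univ \ E, d i = ∑ i, if i ∉ E then d i else 0 := by
    intro E
    rw [← sum_filter]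
    congr 1
    ext i
    simp
  simp_rw [hswap, mul_sum]
  rw [sum_comm]
  refine sum_congr rfl fun i _ => ?_
  have hfilter : S.powerset.filter (fun E => i ∉ E) = (S.erase i).powerset := by
    ext E
    simp [subset_erase]
  simp_rw [mul_ite, mul_zero]
  rw [← sum_filter, hfilter, ← sum_mul]
  congr 1
  have hbin := sum_pow_mul_eq_add_pow p (1 - p) (S.erase i)
  by_cases hi : i ∈ S
  · rw [if_pos hi]
    have hcard := card_erase_add_one hi
    calc ∑ E ∈ (S.erase i).powerset, (1 - p) ^ (#S - #E) * p ^ #E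
        = ∑ E ∈ (S.erase i).powerset, (1 - p) * (p ^ #E * (1 - p) ^ (#(S.erase i) - #E)) := by
          refine sum_congr rfl fun E hE => ?_
          have hle := card_le_card (mem_powerset.1 hE)
          rw [show #S - #E = (#(S.erase i) - #E) + 1 by omega, pow_succ]
          ring
      _ = 1 - p := by rw [← mul_sum, hbin]; simp
  · rw [if_neg hi]
    rw [erase_eq_of_notMem hi] at hbin ⊢
    simp_rw [mul_comm ((1 - p) ^ _), hbin]
    simp

theorem List.forall₂_orderedInsert_ge {l l' : List ℝ} (h : List.Forall₂ (· ≤ ·) l l')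
    (hl : l.Pairwise (· ≥ ·)) (hl' : l'.Pairwise (· ≥ ·)) {a b : ℝ} (hab : a ≤ b) :
    List.Forall₂ (· ≤ ·) (l.orderedInsert (· ≥ ·) a) (l'.orderedInsert (· ≥ ·) b) := by
  induction h generalizing a b with
  | nil => simpa using hab
  | @cons c d cs ds hcd hcs ih =>
    have hc : cs.orderedInsert (· ≥ ·) c = c :: cs := by
      cases cs with
      | nil => rfl
      | cons e es => exact List.orderedInsert_cons_of_le _ _ (by simp at hl; exact hl.1.1)
    have hd : ds.orderedInsert (· ≥ ·) d = d :: ds := by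
      cases ds with
      | nil => rfl
      | cons e es => exact List.orderedInsert_cons_of_le _ _ (by simp at hl'; exact hl'.1.1)
    have ih' := fun {a b : ℝ} (hab : a ≤ b) => ih hl.of_cons hl'.of_cons hab
    rw [List.orderedInsert, List.orderedInsert]
    split_ifs with h1 h2 h2
    · exact .cons hab (.cons hcd hcs)
    · refine .cons (by linarith) ?_
      rw [← hc]
      exact ih' (by linarith)
    · refine .cons (by linarith) ?_
      rw [← hd]
      exact ih' (by linarith)
    · exact .cons hcd (ih' hab)

/-- Sorting in decreasing order is monotone for the entrywise order. -/
theorem List.forall₂_mergeSort_ge {l l' : List ℝ} (h : List.Forall₂ (· ≤ ·) l l') :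
    List.Forall₂ (· ≤ ·) (l.mergeSort (fun a b => decide (b ≤ a)))
      (l'.mergeSort (fun a b => decide (b ≤ a))) := by
  have hsort : ∀ l : List ℝ, l.mergeSort (fun a b => decide (b ≤ a)) =
      l.insertionSort (· ≥ ·) := fun l => List.mergeSort_eq_insertionSort (· ≥ ·) l
  rw [hsort, hsort]
  induction h with
  | nil => exact .nil
  | cons hab _ ih =>
    exact List.forall₂_orderedInsert_ge ih (List.pairwise_insertionSort _ _)
      (List.pairwise_insertionSort _ _) hab

theorem List.Forall₂.getD_le {l l' : List ℝ} (h : List.Forall₂ (· ≤ ·) l l') (i : ℕ) :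
    l.getD i 0 ≤ l'.getD i 0 := by
  induction h generalizing i with
  | nil => simp
  | cons hab _ ih => cases i with
    | zero => simpa using hab
    | succ i => simpa using ih i

theorem List.sum_getD_eq_sum {l : List ℝ} {N : ℕ} (h : l.length ≤ N) :
    ∑ i : Fin N, l.getD i.val 0 = l.sum := by
  induction l generalizing N with
  | nil => simp
  | cons a l ih =>
    cases N with
    | zero => simp at h
    | succ N =>
      rw [Fin.sum_univ_succ]
      simpa using ih (by simpa using h)

section nextVec

variable {N : ℕ} {τ : ℝ → ℝ} (E : Finset (Fin N))

theorem nextVec_mem_Icc (hτmap : ∀ x ∈ Set.Icc (0 : ℝ) 1, τ x ∈ Set.Icc (0 : ℝ) 1)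
    {v : Fin N → ℝ} (hv : ∀ i, v i ∈ Set.Icc (0 : ℝ) 1) (i : Fin N) :
    nextVec N τ E v i ∈ Set.Icc (0 : ℝ) 1 := by
  unfold nextVec
  rw [List.getD_eq_getElem?_getD]
  rcases h : (List.map τ _)[i.val]? with _ | a
  · simp
  · obtain ⟨b, hb, rfl⟩ := List.mem_map.1 (List.mem_of_getElem? h)
    obtain ⟨k, -, rfl⟩ := List.mem_map.1 (List.mem_mergeSort.1 hb)
    exact hτmap _ (hv k)

theorem nextVec_le_nextVec (hτ : MonotoneOn τ (Set.Icc 0 1))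
    {v w : Fin N → ℝ} (hv : ∀ i, v i ∈ Set.Icc (0 : ℝ) 1) (hw : ∀ i, w i ∈ Set.Icc (0 : ℝ) 1)
    (hwv : w ≤ v) : nextVec N τ E w ≤ nextVec N τ E v := by
  intro i
  have hmem : ∀ u : Fin N → ℝ, (∀ i, u i ∈ Set.Icc (0 : ℝ) 1) →
      ∀ a ∈ (((Finset.univ \ E).sort (· ≤ ·)).map u).mergeSort (fun a b => decide (b ≤ a)),
        a ∈ Set.Icc (0 : ℝ) 1 := by
    intro u hu a ha
    obtain ⟨k, -, rfl⟩ := List.mem_map.1 (List.mem_mergeSort.1 ha)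
    exact hu k
  have hsorted := List.forall₂_mergeSort_ge
    (l := ((Finset.univ \ E).sort (· ≤ ·)).map w) (l' := ((Finset.univ \ E).sort (· ≤ ·)).map v)
    (by
      rw [List.forall₂_map_left_iff, List.forall₂_map_right_iff]
      exact List.forall₂_same.2 fun k _ => hwv k)
  refine List.Forall₂.getD_le ?_ _
  rw [List.forall₂_map_left_iff, List.forall₂_map_right_iff]
  rw [List.forall₂_iff_get] at hsorted ⊢
  exact ⟨hsorted.1, fun k h₁ h₂ => hτ (hmem w hw _ (List.get_mem _ _))
    (hmem v hv _ (List.get_mem _ _)) (hsorted.2 k h₁ h₂)⟩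

theorem sum_nextVec (τ : ℝ → ℝ) (v : Fin N → ℝ) :
    ∑ i, nextVec N τ E v i = ∑ i ∈ Finset.univ \ E, τ (v i) := by
  unfold nextVec
  rw [List.sum_getD_eq_sum]
  · rw [((List.mergeSort_perm _ _).map τ).sum_eq, List.map_map,
      ← Multiset.sum_coe, ← Multiset.map_coe, Finset.sort_eq]
    rfl
  · simpa using Finset.card_le_univ (Finset.univ \ E)

end nextVec

theorem sortVec_eq_nextVec (N : ℕ) (v : Fin N → ℝ) : sortVec N v = nextVec N id ∅ v := by
  funext i
  rw [sortVec, nextVec, Finset.sdiff_empty, Fin.sort_univ, List.map_id, List.ofFn_eq_map]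

theorem firstK_apply {N K : ℕ} (hKN : K ≤ N) (v : Fin N → ℝ) (k : Fin K) :
    firstK N K v k = v (Fin.castLE hKN k) := by
  have hk : k.val < N := k.isLt.trans_le hKN
  simp [firstK, hk]
  rfl

theorem card_sched {N K : ℕ} (hKN : K ≤ N) : (sched N K).card = K := by
  simp [sched, Fin.card_filter_val_lt, hKN]

theorem sum_firstK {N K : ℕ} (hKN : K ≤ N) (v : Fin N → ℝ) :
    ∑ k, firstK N K v k = ∑ i, if i ∈ sched N K then v i else 0 := by
  simp_rw [firstK_apply hKN]
  rw [← Finset.sum_filter]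
  refine Finset.sum_bij (fun k _ => Fin.castLE hKN k) ?_ ?_ ?_ ?_
  · simp [sched]
  · intro a _ b _ h
    exact Fin.castLE_injective hKN h
  · intro i hi
    exact ⟨⟨i, by simpa [sched] using hi⟩, by simp, rfl⟩
  · simp

/-- A decomposable reward whose marginal gains are at most `Δ` is one-sidedly `Δ`-Lipschitz for the
`ℓ¹` distance on the unit cube. -/
theorem sub_le_mul_sum_of_decomposable {ι : Type*} [Fintype ι] [DecidableEq ι]
    {R : (ι → ℝ) → ℝ} {Δ : ℝ}
    (hRdec : ∀ (j : ι) (x : ι → ℝ), (∀ k, x k ∈ Set.Icc (0 : ℝ) 1) →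
      R x = x j * R (Function.update x j 1) + (1 - x j) * R (Function.update x j 0))
    (hRbound : ∀ (j : ι) (x : ι → ℝ), (∀ k, x k ∈ Set.Icc (0 : ℝ) 1) →
      R (Function.update x j 1) - R (Function.update x j 0) ≤ Δ)
    {v w : ι → ℝ} (hv : ∀ i, v i ∈ Set.Icc (0 : ℝ) 1) (hw : ∀ i, w i ∈ Set.Icc (0 : ℝ) 1)
    (hwv : w ≤ v) : R v - R w ≤ Δ * ∑ i, (v i - w i) := by
  suffices h : ∀ s : Finset ι, R (s.piecewise v w) - R w ≤ Δ * ∑ i ∈ s, (v i - w i) by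
    simpa using h Finset.univ
  intro s
  induction s using Finset.induction_on with
  | empty => simp
  | insert j s hjs ih =>
    set y := s.piecewise v w with hy_def
    have hy : ∀ k, y k ∈ Set.Icc (0 : ℝ) 1 := by
      intro k
      by_cases hk : k ∈ s
      · simpa [hy_def, hk] using hv k
      · simpa [hy_def, hk] using hw k
    have hyj : y j = w j := by simp [hy_def, hjs]
    have hy' : ∀ k, Function.update y j (v j) k ∈ Set.Icc (0 : ℝ) 1 := by
      intro k
      by_cases hk : k = j
      · subst hk; simpa using hv k
      · simpa [hk] using hy k
    rw [Finset.piecewise_insert, Finset.sum_insert hjs]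
    have h₁ := hRdec j _ hy'
    have h₂ := hRdec j y hy
    simp only [Function.update_idem, Function.update_self] at h₁
    rw [hyj] at h₂
    nlinarith [hRbound j y hy, hwv j]

/-- The discounted sum with survival factor `β(1-p)` is at most `1 / (βp)` when `βp > 0`. -/
theorem mul_geom_sum_le_one {β p : ℝ} (hβ0 : 0 ≤ β) (hβ1 : β ≤ 1) (hp1 : p ≤ 1)
    (m : ℕ) : β * p * ∑ i ∈ Finset.range m, (β * (1 - p)) ^ i ≤ 1 := by
  have hr : 0 ≤ β * (1 - p) := mul_nonneg hβ0 (by linarith)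
  have hu : 0 ≤ ∑ i ∈ Finset.range m, (β * (1 - p)) ^ i :=
    Finset.sum_nonneg fun i _ => pow_nonneg hr i
  have hgeom := geom_sum_mul (β * (1 - p)) m
  nlinarith [pow_nonneg hr m, mul_nonneg (sub_nonneg.2 hβ1) hu]

/-- The pseudo value function is one-sidedly Lipschitz for the entrywise order, sorted or not. -/
theorem W_sub_W_le {N K : ℕ} (hKN : K ≤ N)
    {β p : ℝ} (hβ0 : 0 ≤ β) (hβ1 : β ≤ 1) (hp0 : 0 ≤ p) (hp1 : p ≤ 1)
    {τ : ℝ → ℝ} {R : (Fin K → ℝ) → ℝ} {Δ : ℝ} (hΔ : 0 ≤ Δ)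
    (hRdec : ∀ (j : Fin K) (x : Fin K → ℝ), (∀ k, x k ∈ Set.Icc (0 : ℝ) 1) →
      R x = x j * R (Function.update x j 1) + (1 - x j) * R (Function.update x j 0))
    (hRbound : ∀ (j : Fin K) (x : Fin K → ℝ), (∀ k, x k ∈ Set.Icc (0 : ℝ) 1) →
      R (Function.update x j 1) - R (Function.update x j 0) ≤ Δ)
    (hτmap : ∀ x ∈ Set.Icc (0 : ℝ) 1, τ x ∈ Set.Icc (0 : ℝ) 1)
    (hτmono : MonotoneOn τ (Set.Icc 0 1))
    (hτcon : ∀ x ∈ Set.Icc (0 : ℝ) 1, ∀ y ∈ Set.Icc (0 : ℝ) 1, |τ x - τ y| ≤ |x - y|)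
    (m : ℕ) {v w : Fin N → ℝ} (hv : ∀ i, v i ∈ Set.Icc (0 : ℝ) 1)
    (hw : ∀ i, w i ∈ Set.Icc (0 : ℝ) 1) (hwv : w ≤ v) :
    W N K β p τ R m v - W N K β p τ R m w ≤
      Δ * (∑ i, (v i - w i)) * ∑ i ∈ Finset.range (m + 1), (β * (1 - p)) ^ i := by
  have hreward : ∀ {v w : Fin N → ℝ}, (∀ i, v i ∈ Set.Icc (0 : ℝ) 1) →
      (∀ i, w i ∈ Set.Icc (0 : ℝ) 1) → w ≤ v → R (firstK N K v) - R (firstK N K w) ≤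
        Δ * ∑ i, if i ∈ sched N K then v i - w i else 0 := by
    intro v w hv hw hwv
    have h := sub_le_mul_sum_of_decomposable hRdec hRbound (v := firstK N K v)
      (w := firstK N K w) (fun k => by rw [firstK_apply hKN]; exact hv _)
      (fun k => by rw [firstK_apply hKN]; exact hw _)
      (fun k => by rw [firstK_apply hKN, firstK_apply hKN]; exact hwv _)
    rw [Finset.sum_sub_distrib, sum_firstK hKN, sum_firstK hKN, ← Finset.sum_sub_distrib] at h
    convert h using 4
    split_ifs <;> simp
  induction m generalizing v w with
  | zero =>
    refine (hreward hv hw hwv).trans ?_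
    simp only [zero_add, Finset.range_one, Finset.sum_singleton, pow_zero, mul_one]
    refine mul_le_mul_of_nonneg_left (Finset.sum_le_sum fun i _ => ?_) hΔ
    split_ifs
    exacts [le_rfl, sub_nonneg.2 (hwv i)]
  | succ m ih =>
    set u := ∑ i ∈ Finset.range (m + 1), (β * (1 - p)) ^ i with hu_def
    have hu : 0 ≤ u := Finset.sum_nonneg fun i _ =>
      pow_nonneg (mul_nonneg hβ0 (sub_nonneg.2 hp1)) i
    have hbound : β * p * u ≤ 1 := mul_geom_sum_le_one hβ0 hβ1 hp1 (m + 1)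
    have hu_succ : ∑ i ∈ Finset.range (m + 1 + 1), (β * (1 - p)) ^ i = β * (1 - p) * u + 1 :=
      geom_sum_succ
    have hnext : ∀ E : Finset (Fin N),
        W N K β p τ R m (nextVec N τ E v) - W N K β p τ R m (nextVec N τ E w) ≤
          Δ * u * ∑ i ∈ Finset.univ \ E, (v i - w i) := by
      intro E
      refine (ih (nextVec_mem_Icc E hτmap hv) (nextVec_mem_Icc E hτmap hw)
        (nextVec_le_nextVec E hτmono hv hw hwv)).trans ?_
      rw [Finset.sum_sub_distrib, sum_nextVec, sum_nextVec, ← Finset.sum_sub_distrib,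
        mul_right_comm]
      refine mul_le_mul_of_nonneg_left (Finset.sum_le_sum fun i _ => ?_) (mul_nonneg hΔ hu)
      have h := hτcon _ (hv i) _ (hw i)
      rw [abs_of_nonneg (sub_nonneg.2 (hwv i))] at h
      exact (le_abs_self _).trans h
    have hfuture : ∑ E ∈ (sched N K).powerset, ((1 - p) ^ (K - E.card) * p ^ E.card) *
          (W N K β p τ R m (nextVec N τ E v) - W N K β p τ R m (nextVec N τ E w)) ≤
        Δ * u * ∑ i, (if i ∈ sched N K then 1 - p else 1) * (v i - w i) := by
      rw [← sum_powerset_weight_mul_sum_sdiff, card_sched hKN, Finset.mul_sum]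
      refine Finset.sum_le_sum fun E _ => ?_
      rw [mul_left_comm]
      exact mul_le_mul_of_nonneg_left (hnext E)
        (mul_nonneg (pow_nonneg (sub_nonneg.2 hp1) _) (pow_nonneg hp0 _))
    simp_rw [mul_sub, Finset.sum_sub_distrib] at hfuture
    have hpoint : (∑ i, if i ∈ sched N K then v i - w i else 0) +
        β * u * ∑ i, (if i ∈ sched N K then 1 - p else 1) * (v i - w i) ≤
          (∑ i, (v i - w i)) * (β * (1 - p) * u + 1) := by
      rw [Finset.mul_sum, Finset.sum_mul, ← Finset.sum_add_distrib]
      refine Finset.sum_le_sum fun i _ => ?_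
      split_ifs
      · exact le_of_eq (by ring)
      · nlinarith [mul_nonneg (sub_nonneg.2 (hwv i)) (sub_nonneg.2 hbound)]
    rw [hu_succ, W, W, mul_assoc]
    have h₁ := hreward hv hw hwv
    have h₂ := mul_le_mul_of_nonneg_left hfuture hβ0
    have h₃ := mul_le_mul_of_nonneg_left hpoint hΔ
    simp_rw [mul_sub, Finset.sum_sub_distrib] at h₁ h₂ h₃ ⊢
    linarith

/-- Lemma 2: if `R` is regular (symmetric, nondecreasing in each argument, decomposable)
and bounded with constants `Δl ≤ Δu`, `τ` is a monotonically increasing contracting map, and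
`β ≤ 1`, then for belief vectors `x, x̃` agreeing outside coordinate `j` with `x_j ≥ x̃_j`,
`W_n(sort x) - W_n(sort x̃) ≤ Δu·(x_j - x̃_j)·u(n)` with `u(n) = Σ_{i=0}^{T-n} (β(1-p))^i`. -/
theorem pseudo_value_difference_bound
    (N K T : ℕ) (hK : 1 ≤ K) (hKN : K ≤ N) (hT : 1 ≤ T)
    (β p : ℝ) (hβ0 : 0 < β) (hβ1 : β ≤ 1) (hp0 : 0 ≤ p) (hp1 : p ≤ 1)
    (τ : ℝ → ℝ) (R : (Fin K → ℝ) → ℝ)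
    (hRsym : ∀ (σ : Equiv.Perm (Fin K)) (x : Fin K → ℝ), R (x ∘ σ) = R x)
    (hRmono : ∀ (j : Fin K) (x : Fin K → ℝ), (∀ k, x k ∈ Set.Icc (0 : ℝ) 1) →
      ∀ a b : ℝ, a ∈ Set.Icc (0 : ℝ) 1 → b ∈ Set.Icc (0 : ℝ) 1 → a ≤ b →
        R (Function.update x j a) ≤ R (Function.update x j b))
    (hRdec : ∀ (j : Fin K) (x : Fin K → ℝ), (∀ k, x k ∈ Set.Icc (0 : ℝ) 1) →
      R x = x j * R (Function.update x j 1) + (1 - x j) * R (Function.update x j 0))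
    (Δl Δu : ℝ) (hΔ : Δl ≤ Δu)
    (hRbound : ∀ (j : Fin K) (x : Fin K → ℝ), (∀ k, x k ∈ Set.Icc (0 : ℝ) 1) →
      Δl ≤ R (Function.update x j 1) - R (Function.update x j 0) ∧
        R (Function.update x j 1) - R (Function.update x j 0) ≤ Δu)
    (hτmap : ∀ x ∈ Set.Icc (0 : ℝ) 1, τ x ∈ Set.Icc (0 : ℝ) 1)
    (hτmono : ∀ x ∈ Set.Icc (0 : ℝ) 1, ∀ y ∈ Set.Icc (0 : ℝ) 1, y < x → τ y < τ x)
    (hτcon : ∀ x ∈ Set.Icc (0 : ℝ) 1, ∀ y ∈ Set.Icc (0 : ℝ) 1, |τ x - τ y| ≤ |x - y|)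
    (j : Fin N) (x xt : Fin N → ℝ)
    (hx : ∀ i, x i ∈ Set.Icc (0 : ℝ) 1) (hxt : ∀ i, xt i ∈ Set.Icc (0 : ℝ) 1)
    (hagree : ∀ k, k ≠ j → x k = xt k) (hj : xt j ≤ x j)
    (n : ℕ) (hn1 : 1 ≤ n) (hnT : n ≤ T) :
    W N K β p τ R (T - n) (sortVec N x) - W N K β p τ R (T - n) (sortVec N xt) ≤
      Δu * (x j - xt j) * ∑ i ∈ Finset.range (T - n + 1), (β * (1 - p)) ^ i := by
  have hτmono' : MonotoneOn τ (Set.Icc 0 1) := StrictMonoOn.monotoneOn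
    fun a ha b hb hab => hτmono b hb a ha hab
  have hΔu : 0 ≤ Δu := by
    have hzero : ∀ _ : Fin K, (0 : ℝ) ∈ Set.Icc (0 : ℝ) 1 := fun _ => by simp
    have h₁ := hRmono ⟨0, hK⟩ (fun _ => 0) hzero 0 1 (by simp) (by simp) zero_le_one
    have h₂ := (hRbound ⟨0, hK⟩ (fun _ => 0) hzero).2
    linarith
  have hle : xt ≤ x := by
    intro k
    by_cases hk : k = j
    · exact hk ▸ hj
    · exact (hagree k hk).ge
  have hsum : ∑ i, (x i - xt i) = x j - xt j :=
    Finset.sum_eq_single j (fun k _ hk => by rw [hagree k hk, sub_self]) (by simp)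
  have hid : ∀ a ∈ Set.Icc (0 : ℝ) 1, id a ∈ Set.Icc (0 : ℝ) 1 := fun _ ha => ha
  rw [sortVec_eq_nextVec, sortVec_eq_nextVec]
  refine (W_sub_W_le hKN hβ0.le hβ1 hp0 hp1 hΔu hRdec (fun j x hx => (hRbound j x hx).2) hτmap
    hτmono' hτcon (T - n) (nextVec_mem_Icc ∅ hid hx) (nextVec_mem_Icc ∅ hid hxt)
    (nextVec_le_nextVec ∅ monotoneOn_id hx hxt hle)).trans_eq ?_
  rw [Finset.sum_sub_distrib, sum_nextVec, sum_nextVec, ← Finset.sum_sub_distrib]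
  simp only [Finset.sdiff_empty, id_eq, hsum]
end

section
/- (Theorem 1.) Assume R : [0,1]^K → ℝ is regular (symmetric, nondecreasing in each argument, and decomposable) and bounded with constants Δ_l ≤ Δ_u, that τ is a monotonically increasing contracting map, that β ≤ 1, and that Δ_l ≥ Δ_u·β·p·(1 − (β(1−p))^{T+1})/(1 − β(1−p)). Then the myopic policy is optimal: for every scheduling policy π, every time 1 ≤ n ≤ T, and every belief vector s ∈ [0,1]^N, V^π_n(s) ≤ W_n(sort(s)), where sort(s) is s rearranged in decreasing order. -/
/-- The restriction of a belief vector `s` to a size-`K` subset `A` of its coordinates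
(listed in increasing index order), as a vector of length `K`. -/
noncomputable def restr (N K : ℕ) (A : Finset (Fin N)) (s : Fin N → ℝ) : Fin K → ℝ :=
  fun k => ((A.sort (· ≤ ·)).map s).getD k.val 0

/-- The value function of a scheduling policy `pol`, indexed by remaining time:
`Vpol … m s` is the value `V^π_n(s)` of the paper with `m = T - n` slots remaining;
`V^π_T(s) = R(s|_{π_T(s)})` and
`V^π_n(s) = R(s|_{π_n(s)}) + β·Σ_{E ⊆ π_n(s)} (1-p)^(K-|E|) p^|E| · V^π_{n+1}(s')`, where
`s'_i = 0` for `i ∈ E` and `s'_i = τ(s_i)` for `i ∉ E`. -/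
noncomputable def Vpol (N K T : ℕ) (β p : ℝ) (τ : ℝ → ℝ) (R : (Fin K → ℝ) → ℝ)
    (pol : ℕ → (Fin N → ℝ) → Finset (Fin N)) : ℕ → (Fin N → ℝ) → ℝ
  | 0, s => R (restr N K (pol T s) s)
  | m + 1, s => R (restr N K (pol (T - (m + 1)) s) s) +
      β * ∑ E ∈ (pol (T - (m + 1)) s).powerset,
        ((1 - p) ^ (K - E.card) * p ^ E.card) *
          Vpol N K T β p τ R pol m (fun i => if i ∈ E then 0 else τ (s i))

/-- The belief vector of the next slot when exactly the channels in `E` are active. -/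
noncomputable def stepVec {N : ℕ} (τ : ℝ → ℝ) (E : Finset (Fin N)) (s : Fin N → ℝ) : Fin N → ℝ :=
  fun i => if i ∈ E then 0 else τ (s i)

/-- The value of scheduling `A` now and following the myopic policy afterwards. -/
noncomputable def stageValue (N K : ℕ) (β p : ℝ) (τ : ℝ → ℝ) (R : (Fin K → ℝ) → ℝ) :
    ℕ → Finset (Fin N) → (Fin N → ℝ) → ℝ
  | 0, A, s => R (restr N K A s)
  | m + 1, A, s => R (restr N K A s) +
      β * ∑ E ∈ A.powerset, ((1 - p) ^ (K - E.card) * p ^ E.card) *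
        W N K β p τ R m (sortVec N (stepVec τ E s))

/-- Lipschitz constant of the myopic value function with `m` slots remaining. -/
noncomputable def lipConst (β p Δu : ℝ) (m : ℕ) : ℝ :=
  Δu * ∑ i ∈ Finset.range (m + 1), (β * (1 - p)) ^ i

/-- The increments of `R` in each coordinate over the unit cube have slope in `[Δl, Δu]`. -/
def HasIncrementBounds {K : ℕ} (R : (Fin K → ℝ) → ℝ) (Δl Δu : ℝ) : Prop :=
  ∀ (k : Fin K) (x : Fin K → ℝ), (∀ i, x i ∈ Set.Icc (0 : ℝ) 1) → ∀ a ∈ Set.Icc (0 : ℝ) 1,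
    a ≤ x k → Δl * (x k - a) ≤ R x - R (Function.update x k a) ∧
      R x - R (Function.update x k a) ≤ Δu * (x k - a)

theorem hasIncrementBounds_of_decomposable {K : ℕ} {R : (Fin K → ℝ) → ℝ} {Δl Δu : ℝ}
    (hRdec : ∀ (j : Fin K) (x : Fin K → ℝ), (∀ k, x k ∈ Set.Icc (0 : ℝ) 1) →
      R x = x j * R (Function.update x j 1) + (1 - x j) * R (Function.update x j 0))
    (hRbound : ∀ (j : Fin K) (x : Fin K → ℝ), (∀ k, x k ∈ Set.Icc (0 : ℝ) 1) →
      Δl ≤ R (Function.update x j 1) - R (Function.update x j 0) ∧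
        R (Function.update x j 1) - R (Function.update x j 0) ≤ Δu) :
    HasIncrementBounds R Δl Δu := by
  intro k x hx a ha hax
  have hu : ∀ i, Function.update x k a i ∈ Set.Icc (0 : ℝ) 1 := by
    intro i
    by_cases h : i = k
    · subst h; simpa using ha
    · simpa [Function.update_of_ne h] using hx i
  have h1 := hRdec k x hx
  have h2 := hRdec k _ hu
  simp only [Function.update_self, Function.update_idem] at h2
  obtain ⟨hl, hr⟩ := hRbound k x hx
  have hd : 0 ≤ x k - a := sub_nonneg.2 hax
  have e : R x - R (Function.update x k a) =
      (R (Function.update x k 1) - R (Function.update x k 0)) * (x k - a) := by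
    rw [h1, h2]; ring
  rw [e]
  exact ⟨mul_le_mul_of_nonneg_right hl hd, mul_le_mul_of_nonneg_right hr hd⟩

theorem lipConst_zero (β p Δu : ℝ) : lipConst β p Δu 0 = Δu := by
  simp [lipConst]

theorem lipConst_succ (β p Δu : ℝ) (m : ℕ) :
    lipConst β p Δu (m + 1) = Δu + β * (1 - p) * lipConst β p Δu m := by
  rw [lipConst, Finset.sum_range_succ', lipConst, mul_add, pow_zero, mul_one, add_comm]
  simp only [pow_succ, ← Finset.sum_mul]
  ring

theorem lipConst_nonneg {β p Δu : ℝ} (hβ : 0 ≤ β) (hp : p ≤ 1) (hΔ : 0 ≤ Δu) (m : ℕ) :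
    0 ≤ lipConst β p Δu m :=
  mul_nonneg hΔ (Finset.sum_nonneg fun _ _ => pow_nonneg (mul_nonneg hβ (sub_nonneg.2 hp)) _)

theorem lipConst_mono {β p Δu : ℝ} (hβ : 0 ≤ β) (hp : p ≤ 1) (hΔ : 0 ≤ Δu) {m n : ℕ}
    (hmn : m ≤ n) : lipConst β p Δu m ≤ lipConst β p Δu n :=
  mul_le_mul_of_nonneg_left
    (Finset.sum_le_sum_of_subset_of_nonneg (Finset.range_mono (by omega))
      fun _ _ _ => pow_nonneg (mul_nonneg hβ (sub_nonneg.2 hp)) _) hΔ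

/-- The geometric condition bounds `β p` times the Lipschitz constants by `Δl`. -/
theorem mul_lipConst_le {β p Δl Δu : ℝ} (hβ0 : 0 < β) (hβ1 : β ≤ 1) (hp0 : 0 ≤ p) (hp1 : p ≤ 1)
    (hΔ : 0 ≤ Δu) {T m : ℕ} (hm : m ≤ T)
    (hcond : Δu * β * p * ((1 - (β * (1 - p)) ^ (T + 1)) / (1 - β * (1 - p))) ≤ Δl) :
    β * p * lipConst β p Δu m ≤ Δl := by
  rcases eq_or_ne (β * (1 - p)) 1 with h | h
  · have hp : p = 0 := by nlinarith
    subst hp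
    simpa using hcond
  · refine (mul_le_mul_of_nonneg_left (lipConst_mono hβ0.le hp1 hΔ hm)
      (mul_nonneg hβ0.le hp0)).trans ?_
    rw [lipConst, geom_sum_eq h, ← neg_div_neg_eq, neg_sub, neg_sub]
    linarith

theorem eq_of_range_eq {K N : ℕ} {R : (Fin K → ℝ) → ℝ}
    (hRsym : ∀ (σ : Equiv.Perm (Fin K)) (x : Fin K → ℝ), R (x ∘ σ) = R x)
    {e f : Fin K → Fin N} (he : Function.Injective e) (hf : Function.Injective f)
    (hef : Set.range e = Set.range f) (s : Fin N → ℝ) : R (s ∘ e) = R (s ∘ f) := by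
  let σ : Equiv.Perm (Fin K) :=
    (Equiv.ofInjective e he).trans ((Equiv.setCongr hef).trans (Equiv.ofInjective f hf).symm)
  have hσ : f ∘ σ = e := by
    funext k
    exact congrArg Subtype.val
      ((Equiv.ofInjective f hf).apply_symm_apply (Equiv.setCongr hef (Equiv.ofInjective e he k)))
  rw [← hσ, ← Function.comp_assoc, hRsym]

theorem restr_eq_comp {N K : ℕ} {A : Finset (Fin N)} (hA : A.card = K) (s : Fin N → ℝ) :
    restr N K A s = s ∘ A.orderEmbOfFin hA := by
  funext k
  rw [restr, List.getD_eq_getElem _ _ (by simp [hA, k.2]), List.getElem_map, Function.comp_apply,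
    Finset.orderEmbOfFin_apply]
  rfl

theorem apply_restr_eq {N K : ℕ} {R : (Fin K → ℝ) → ℝ}
    (hRsym : ∀ (σ : Equiv.Perm (Fin K)) (x : Fin K → ℝ), R (x ∘ σ) = R x)
    {A : Finset (Fin N)} (hA : A.card = K) {e : Fin K → Fin N} (he : Function.Injective e)
    (hr : Set.range e = A) (s : Fin N → ℝ) : R (restr N K A s) = R (s ∘ e) := by
  rw [restr_eq_comp hA]
  exact eq_of_range_eq hRsym (A.orderEmbOfFin hA).injective he
    (by rw [Finset.range_orderEmbOfFin, hr]) s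

theorem firstK_eq_comp {N K : ℕ} (hKN : K ≤ N) (v : Fin N → ℝ) :
    firstK N K v = v ∘ Fin.castLE hKN := by
  funext k
  rw [firstK, List.getD_eq_getElem _ _ (by simp; omega)]
  simp [Fin.castLE]

/-- Raising coordinate `i` of the beliefs raises the reward of `A ∋ i` by a slope at most `Δu`. -/
theorem reward_update_le {N K : ℕ} {R : (Fin K → ℝ) → ℝ} {Δl Δu : ℝ}
    (hRinc : HasIncrementBounds R Δl Δu) {A : Finset (Fin N)} (hA : A.card = K)
    {s : Fin N → ℝ} (hs : ∀ i, s i ∈ Set.Icc (0 : ℝ) 1) {i : Fin N} (hi : i ∈ A) {y : ℝ}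
    (hy : y ∈ Set.Icc (0 : ℝ) 1) (hys : y ≤ s i) :
    R (restr N K A s) - R (restr N K A (Function.update s i y)) ≤ Δu * (s i - y) := by
  obtain ⟨k, rfl⟩ : ∃ k, A.orderEmbOfFin hA k = i := by
    have : i ∈ Set.range (A.orderEmbOfFin hA) := by rwa [Finset.range_orderEmbOfFin]
    exact this
  rw [restr_eq_comp hA, restr_eq_comp hA,
    Function.update_comp_eq_of_injective _ (A.orderEmbOfFin hA).injective]
  exact (hRinc k (s ∘ A.orderEmbOfFin hA) (fun j => hs _) y hy hys).2

theorem restr_update_of_notMem {N K : ℕ} {A : Finset (Fin N)} (hA : A.card = K)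
    (s : Fin N → ℝ) {i : Fin N} (hi : i ∉ A) (y : ℝ) :
    restr N K A (Function.update s i y) = restr N K A s := by
  rw [restr_eq_comp hA, restr_eq_comp hA]
  funext k
  have : A.orderEmbOfFin hA k ≠ i := fun h => hi (h ▸ A.orderEmbOfFin_mem hA k)
  simp [Function.update_of_ne this]

/-- Replacing a scheduled index `i` by an index `j` of larger belief gains a slope of at least
`Δl` in the immediate reward. -/
theorem le_reward_exchange {N K : ℕ} {R : (Fin K → ℝ) → ℝ} {Δl Δu : ℝ}
    (hRsym : ∀ (σ : Equiv.Perm (Fin K)) (x : Fin K → ℝ), R (x ∘ σ) = R x)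
    (hRinc : HasIncrementBounds R Δl Δu) {C : Finset (Fin N)} {i j : Fin N} (hi : i ∉ C)
    (hj : j ∉ C) (hC : C.card + 1 = K) {s : Fin N → ℝ} (hs : ∀ i, s i ∈ Set.Icc (0 : ℝ) 1)
    (hij : s i ≤ s j) :
    Δl * (s j - s i) ≤ R (restr N K (insert j C) s) - R (restr N K (insert i C) s) := by
  have hcj : (insert j C).card = K := by rw [Finset.card_insert_of_notMem hj, hC]
  have hci : (insert i C).card = K := by rw [Finset.card_insert_of_notMem hi, hC]
  let e := (insert j C).orderEmbOfFin hcj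
  have hre : Set.range e = ↑(insert j C) := Finset.range_orderEmbOfFin _ hcj
  obtain ⟨k, hk⟩ : ∃ k, e k = j := by
    have : j ∈ Set.range e := by rw [hre]; simp
    exact this
  have hsw : s ∘ (Equiv.swap i j ∘ e) = Function.update (s ∘ e) k (s i) := by
    funext l
    by_cases h : l = k
    · subst h; simp [hk]
    · have hlj : e l ≠ j := fun h' => h (e.injective (h'.trans hk.symm))
      have hli : e l ≠ i := by
        intro h'
        have : e l ∈ insert j C := Finset.orderEmbOfFin_mem _ hcj l
        rcases Finset.mem_insert.1 this with h2 | h2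
        · exact hlj h2
        · exact hi (h' ▸ h2)
      simp [Function.update_of_ne h, Equiv.swap_apply_of_ne_of_ne hli hlj]
  have hri : R (restr N K (insert i C) s) = R (Function.update (s ∘ e) k (s i)) := by
    rw [← hsw]
    refine apply_restr_eq hRsym hci ((Equiv.swap i j).injective.comp e.injective) ?_ s
    rw [Set.range_comp, hre, Finset.coe_insert, Finset.coe_insert, Set.image_insert_eq,
      Equiv.swap_apply_right]
    congr 1
    ext x
    constructor
    · rintro ⟨y, hy, rfl⟩
      rwa [Equiv.swap_apply_of_ne_of_ne (ne_of_mem_of_not_mem hy hi)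
        (ne_of_mem_of_not_mem hy hj)]
    · intro hx
      exact ⟨x, hx, Equiv.swap_apply_of_ne_of_ne (ne_of_mem_of_not_mem hx hi)
        (ne_of_mem_of_not_mem hx hj)⟩
  rw [hri, restr_eq_comp hcj]
  have := (hRinc k (s ∘ e) (fun l => hs _) (s i) (hs i) (by simpa [hk] using hij)).1
  simpa [hk, e] using this

theorem pairwise_mergeSort_ge (l : List ℝ) :
    (l.mergeSort (fun a b => decide (b ≤ a))).Pairwise (· ≥ ·) := by
  have := List.pairwise_mergeSort (le := fun a b : ℝ => decide (b ≤ a))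
    (by intro a b c; simpa using fun h1 h2 => le_trans h2 h1)
    (by intro a b; simpa using le_total b a) l
  exact this.imp (by simp)

theorem sortVec_eq_getD {N : ℕ} {v : Fin N → ℝ} {l : List ℝ} (hl : l.Pairwise (· ≥ ·))
    (hp : l.Perm (List.ofFn v)) : sortVec N v = fun i => l.getD i.val 0 := by
  have : (List.ofFn v).mergeSort (fun a b => decide (b ≤ a)) = l :=
    ((List.mergeSort_perm _ _).trans hp.symm).eq_of_pairwise' (pairwise_mergeSort_ge _) hl
  funext i
  rw [sortVec, this]

theorem sortVec_comp {N : ℕ} (σ : Equiv.Perm (Fin N)) (v : Fin N → ℝ) :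
    sortVec N (v ∘ σ) = sortVec N v :=
  (sortVec_eq_getD (pairwise_mergeSort_ge _)
    ((List.mergeSort_perm _ _).trans (σ.ofFn_comp_perm v).symm))

theorem exists_sortVec_eq_comp {N : ℕ} (v : Fin N → ℝ) :
    ∃ σ : Equiv.Perm (Fin N), sortVec N v = v ∘ σ ∧ Antitone (v ∘ σ) := by
  obtain ⟨σ, hσ⟩ : ∃ σ : Equiv.Perm (Fin N), Antitone (v ∘ σ) :=
    ⟨Tuple.sort (fun i => -v i), fun i j hij => by
      have := Tuple.monotone_sort (fun i => -v i) hij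
      simpa using this⟩
  refine ⟨σ, ?_, hσ⟩
  rw [sortVec_eq_getD (l := List.ofFn (v ∘ σ)) ?_ (σ.ofFn_comp_perm v)]
  · funext i
    rw [List.getD_eq_getElem _ _ (by simp)]
    simp
  · exact List.pairwise_ofFn.2 fun i j hij => hσ hij.le

theorem stepVec_mem {N : ℕ} {τ : ℝ → ℝ} (hτmap : ∀ x ∈ Set.Icc (0 : ℝ) 1, τ x ∈ Set.Icc (0 : ℝ) 1)
    (E : Finset (Fin N)) {s : Fin N → ℝ} (hs : ∀ i, s i ∈ Set.Icc (0 : ℝ) 1) (i : Fin N) :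
    stepVec τ E s i ∈ Set.Icc (0 : ℝ) 1 := by
  unfold stepVec
  split_ifs
  · simp
  · exact hτmap _ (hs i)

theorem stepVec_comp {N : ℕ} (τ : ℝ → ℝ) (σ : Equiv.Perm (Fin N)) (E : Finset (Fin N))
    (s : Fin N → ℝ) : stepVec τ E (s ∘ σ) = stepVec τ (E.map σ.toEmbedding) s ∘ σ := by
  funext i
  simp [stepVec]

/-- The next belief vector of the pseudo value function is the sorted true next belief vector. -/
theorem nextVec_eq_sortVec {N : ℕ} {τ : ℝ → ℝ}
    (hτmap : ∀ x ∈ Set.Icc (0 : ℝ) 1, τ x ∈ Set.Icc (0 : ℝ) 1)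
    (hτmono : ∀ x ∈ Set.Icc (0 : ℝ) 1, ∀ y ∈ Set.Icc (0 : ℝ) 1, y < x → τ y < τ x)
    (E : Finset (Fin N)) {v : Fin N → ℝ} (hv : ∀ i, v i ∈ Set.Icc (0 : ℝ) 1) :
    nextVec N τ E v = sortVec N (stepVec τ E v) := by
  set l := (((Finset.univ \ E).sort (· ≤ ·)).map v).mergeSort (fun a b => decide (b ≤ a)) with hl
  have hlp : l.Perm (((Finset.univ \ E).sort (· ≤ ·)).map v) := List.mergeSort_perm _ _
  have hmem : ∀ x ∈ l, x ∈ Set.Icc (0 : ℝ) 1 := by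
    intro x hx
    obtain ⟨i, -, rfl⟩ := List.mem_map.1 (hlp.subset hx)
    exact hv i
  have hpair : (l.map τ ++ List.replicate E.card 0).Pairwise (· ≥ ·) := by
    rw [List.pairwise_append]
    refine ⟨?_, by simp [List.pairwise_replicate], ?_⟩
    · rw [List.pairwise_map]
      refine (pairwise_mergeSort_ge _).imp_of_mem ?_
      intro a b ha hb hab
      rcases hab.eq_or_lt with h | h
      · rw [h]
      · exact (hτmono _ (hmem a ha) _ (hmem b hb) h).le
    · intro a ha b hb
      obtain ⟨x, hx, rfl⟩ := List.mem_map.1 ha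
      rw [(List.mem_replicate.1 hb).2]
      exact (hτmap x (hmem x hx)).1
  have hperm : (l.map τ ++ List.replicate E.card 0).Perm (List.ofFn (stepVec τ E v)) := by
    rw [← Multiset.coe_eq_coe, ← Multiset.coe_add, ← Multiset.map_coe,
      Multiset.coe_eq_coe.2 hlp, ← Multiset.map_coe, Finset.sort_eq]
    have h1 : (↑(List.ofFn (stepVec τ E v)) : Multiset ℝ) =
        (Finset.univ : Finset (Fin N)).val.map (stepVec τ E v) := by
      rw [Fin.univ_val_map]
    have h2 : (Finset.univ : Finset (Fin N)).val = (Finset.univ \ E).val + E.val := by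
      rw [Finset.sdiff_val, tsub_add_cancel_of_le (Finset.val_le_iff.2 (Finset.subset_univ E))]
    rw [h1, h2, Multiset.map_add, Multiset.map_map]
    congr 1
    · refine Multiset.map_congr rfl fun i hi => ?_
      have : i ∉ E := (Finset.mem_sdiff.1 hi).2
      simp [stepVec, this]
    · rw [Multiset.map_congr (g := fun _ => (0 : ℝ)) rfl fun i hi => by
        have : i ∈ E := hi
        simp [stepVec, this]]
      rw [Multiset.map_const', Multiset.coe_replicate, Finset.card_val]
  rw [sortVec_eq_getD hpair hperm]
  funext i
  rw [nextVec, ← hl]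
  rcases lt_or_ge i.val (l.map τ).length with h | h
  · rw [List.getD_append _ _ _ _ h]
  · rw [List.getD_append_right _ _ _ _ h, List.getD_eq_default _ _ h]
    simp

/-- The myopic policy schedules some size-`K` set and continues myopically. -/
theorem exists_W_eq_stageValue {N K : ℕ} (hKN : K ≤ N) {β p : ℝ} {τ : ℝ → ℝ}
    {R : (Fin K → ℝ) → ℝ}
    (hRsym : ∀ (σ : Equiv.Perm (Fin K)) (x : Fin K → ℝ), R (x ∘ σ) = R x)
    (hτmap : ∀ x ∈ Set.Icc (0 : ℝ) 1, τ x ∈ Set.Icc (0 : ℝ) 1)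
    (hτmono : ∀ x ∈ Set.Icc (0 : ℝ) 1, ∀ y ∈ Set.Icc (0 : ℝ) 1, y < x → τ y < τ x)
    (m : ℕ) {s : Fin N → ℝ} (hs : ∀ i, s i ∈ Set.Icc (0 : ℝ) 1) :
    ∃ A : Finset (Fin N), A.card = K ∧
      W N K β p τ R m (sortVec N s) = stageValue N K β p τ R m A s ∧
      ∀ i ∈ A, ∀ j ∉ A, s j ≤ s i := by
  obtain ⟨σ, hσ, hanti⟩ := exists_sortVec_eq_comp s
  have hA : ((sched N K).map σ.toEmbedding).card = K := by rw [Finset.card_map, card_sched hKN]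
  have hR : R (firstK N K (s ∘ σ)) = R (restr N K ((sched N K).map σ.toEmbedding) s) := by
    rw [firstK_eq_comp hKN, Function.comp_assoc]
    refine (apply_restr_eq hRsym hA (σ.injective.comp (Fin.castLE_injective hKN)) ?_ s).symm
    rw [Set.range_comp, Fin.range_castLE, Finset.coe_map]
    simp [sched]
  refine ⟨_, hA, ?_, ?_⟩
  · rw [hσ]
    cases m with
    | zero => exact hR
    | succ m =>
      rw [W, stageValue, hR]
      congr 2
      refine Finset.sum_bij (fun E _ => E.map σ.toEmbedding) ?_ ?_ ?_ ?_
      · intro E hE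
        exact Finset.mem_powerset.2 (Finset.map_subset_map.2 (Finset.mem_powerset.1 hE))
      · intro E _ F _ h
        exact Finset.map_injective _ h
      · intro F hF
        obtain ⟨E, hE, rfl⟩ := Finset.subset_map_iff.1 (Finset.mem_powerset.1 hF)
        exact ⟨E, Finset.mem_powerset.2 hE, rfl⟩
      · intro E _
        rw [nextVec_eq_sortVec hτmap hτmono E (v := s ∘ σ) (fun i => hs (σ i)), stepVec_comp, sortVec_comp,
          Finset.card_map]
  · intro i hi j hj
    obtain ⟨a, ha, rfl⟩ := Finset.mem_map.1 hi
    have hb : σ.symm j ∉ sched N K := fun h => hj (Finset.mem_map.2 ⟨_, h, by simp⟩)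
    have hab : a ≤ σ.symm j := by
      simp only [sched, Finset.mem_filter, Finset.mem_univ, true_and, not_lt] at ha hb
      exact Fin.le_def.2 (ha.le.trans hb)
    simpa using hanti hab

/-- The expectation over active subsets of `insert i C`, conditioned on whether `i` is active. -/
theorem sum_powerset_insert_weight {ι : Type*} [DecidableEq ι] {C : Finset ι} {i : ι} {K : ℕ}
    (hi : i ∉ C) (hC : C.card + 1 = K) (p : ℝ) (f : Finset ι → ℝ) :
    ∑ E ∈ (insert i C).powerset, ((1 - p) ^ (K - E.card) * p ^ E.card) * f E =
      ∑ E ∈ C.powerset, ((1 - p) ^ (C.card - E.card) * p ^ E.card) *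
        ((1 - p) * f E + p * f (insert i E)) := by
  rw [Finset.sum_powerset_insert hi, ← Finset.sum_add_distrib]
  refine Finset.sum_congr rfl fun E hE => ?_
  have hEC := Finset.mem_powerset.1 hE
  have hcard := Finset.card_le_card hEC
  rw [Finset.card_insert_of_notMem fun h => hi (hEC h),
    show K - E.card = (C.card - E.card) + 1 by omega,
    show K - (E.card + 1) = C.card - E.card by omega]
  ring

theorem sum_powerset_weight_le {ι : Type*} {C : Finset ι} {p : ℝ} (hp0 : 0 ≤ p) (hp1 : p ≤ 1)
    {f g : Finset ι → ℝ} {c : ℝ} (h : ∀ E ⊆ C, f E - g E ≤ c) :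
    ∑ E ∈ C.powerset, ((1 - p) ^ (C.card - E.card) * p ^ E.card) * f E -
      ∑ E ∈ C.powerset, ((1 - p) ^ (C.card - E.card) * p ^ E.card) * g E ≤ c := by
  have hone : ∑ E ∈ C.powerset, ((1 - p) ^ (C.card - E.card) * p ^ E.card) = 1 := by
    simp_rw [mul_comm ((1 - p) ^ _), Finset.sum_pow_mul_eq_add_pow]
    simp
  calc _ = ∑ E ∈ C.powerset, ((1 - p) ^ (C.card - E.card) * p ^ E.card) * (f E - g E) := by
        rw [← Finset.sum_sub_distrib]
        simp_rw [mul_sub]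
    _ ≤ ∑ E ∈ C.powerset, ((1 - p) ^ (C.card - E.card) * p ^ E.card) * c :=
        Finset.sum_le_sum fun E hE => mul_le_mul_of_nonneg_left (h E (Finset.mem_powerset.1 hE))
          (mul_nonneg (pow_nonneg (sub_nonneg.2 hp1) _) (pow_nonneg hp0 _))
    _ = c := by rw [← Finset.sum_mul, hone, one_mul]

/-- Pointwise monotone improvement by exchanges leads from any `A` to a set `B` of top indices. -/
theorem le_of_exchange {ι : Type*} [DecidableEq ι] {K : ℕ} (s : ι → ℝ) (Q : Finset ι → ℝ)
    (hQ : ∀ (C : Finset ι) (i j : ι), i ∉ C → j ∉ C → C.card + 1 = K → s i ≤ s j →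
      Q (insert i C) ≤ Q (insert j C))
    {B : Finset ι} (hB : B.card = K) (htop : ∀ j ∈ B, ∀ i ∉ B, s i ≤ s j)
    {A : Finset ι} (hA : A.card = K) : Q A ≤ Q B := by
  induction h : (A \ B).card generalizing A with
  | zero =>
    have hAB : A ⊆ B := Finset.sdiff_eq_empty_iff_subset.1 (Finset.card_eq_zero.1 h)
    rw [Finset.eq_of_subset_of_card_le hAB (by omega)]
  | succ n ih =>
    obtain ⟨i, hi⟩ : (A \ B).Nonempty := Finset.card_pos.1 (by omega)
    have hBA : (B \ A).card = (A \ B).card := Finset.card_sdiff_comm (by omega)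
    obtain ⟨j, hj⟩ : (B \ A).Nonempty := Finset.card_pos.1 (by omega)
    rw [Finset.mem_sdiff] at hi hj
    have hjC : j ∉ A.erase i := fun hm => hj.2 (Finset.mem_of_mem_erase hm)
    have hcard : (A.erase i).card + 1 = K := by rw [Finset.card_erase_add_one hi.1, hA]
    have hstep := hQ (A.erase i) i j (Finset.notMem_erase i A) hjC hcard (htop j hj.1 i hi.2)
    rw [Finset.insert_erase hi.1] at hstep
    refine hstep.trans (ih (by rw [Finset.card_insert_of_notMem hjC, hcard]) ?_)
    rw [Finset.insert_sdiff_of_mem _ hj.1, Finset.erase_sdiff_comm,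
      Finset.card_erase_of_mem (Finset.mem_sdiff.2 hi), h]
    rfl

theorem stepVec_update_of_mem {N : ℕ} (τ : ℝ → ℝ) {E : Finset (Fin N)} {i : Fin N} (hi : i ∈ E)
    (s : Fin N → ℝ) (y : ℝ) : stepVec τ E (Function.update s i y) = stepVec τ E s := by
  funext k
  by_cases h : k = i
  · subst h; simp [stepVec, hi]
  · simp [stepVec, Function.update_of_ne h]

theorem stepVec_update_of_notMem {N : ℕ} (τ : ℝ → ℝ) {E : Finset (Fin N)} {i : Fin N} (hi : i ∉ E)
    (s : Fin N → ℝ) (y : ℝ) :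
    stepVec τ E (Function.update s i y) = Function.update (stepVec τ E s) i (τ y) := by
  funext k
  by_cases h : k = i
  · subst h; simp [stepVec, hi]
  · simp [stepVec, Function.update_of_ne h]

/-- Resetting `j` instead of `i` is, up to a transposition, lowering coordinate `j`. -/
theorem stepVec_insert_comp_swap {N : ℕ} (τ : ℝ → ℝ) {E : Finset (Fin N)} {i j : Fin N}
    (hij : i ≠ j) (hi : i ∉ E) (hj : j ∉ E) (s : Fin N → ℝ) :
    stepVec τ (insert j E) s ∘ Equiv.swap i j =
      Function.update (stepVec τ (insert i E) s) j (τ (s i)) := by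
  funext k
  by_cases hkj : k = j
  · subst hkj; simp [stepVec, hi, hij]
  · by_cases hki : k = i
    · subst hki; simp [stepVec, hij]
    · simp [stepVec, Equiv.swap_apply_of_ne_of_ne hki hkj, hkj, hki]

/-- If the myopic value function has one-sided Lipschitz constant `L` at the next slot, and
`β p L ≤ Δl`, then exchanging a scheduled index for one of larger belief is profitable. -/
theorem stageValue_succ_exchange {N K : ℕ} {β p : ℝ} (hβ0 : 0 ≤ β) (hp0 : 0 ≤ p) (hp1 : p ≤ 1)
    {τ : ℝ → ℝ} {R : (Fin K → ℝ) → ℝ} {Δl Δu L : ℝ}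
    (hRsym : ∀ (σ : Equiv.Perm (Fin K)) (x : Fin K → ℝ), R (x ∘ σ) = R x)
    (hRinc : HasIncrementBounds R Δl Δu)
    (hτmap : ∀ x ∈ Set.Icc (0 : ℝ) 1, τ x ∈ Set.Icc (0 : ℝ) 1)
    (hτ : ∀ x ∈ Set.Icc (0 : ℝ) 1, ∀ y ∈ Set.Icc (0 : ℝ) 1, y ≤ x →
      τ y ≤ τ x ∧ τ x - τ y ≤ x - y)
    (hL0 : 0 ≤ L) (hL : β * p * L ≤ Δl) {m : ℕ}
    (hlip : ∀ (s : Fin N → ℝ) (i : Fin N) (y : ℝ), (∀ i, s i ∈ Set.Icc (0 : ℝ) 1) →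
      y ∈ Set.Icc (0 : ℝ) 1 → y ≤ s i → W N K β p τ R m (sortVec N s) -
        W N K β p τ R m (sortVec N (Function.update s i y)) ≤ L * (s i - y))
    {s : Fin N → ℝ} (hs : ∀ i, s i ∈ Set.Icc (0 : ℝ) 1) {C : Finset (Fin N)} {i j : Fin N}
    (hi : i ∉ C) (hj : j ∉ C) (hC : C.card + 1 = K) (hij : s i ≤ s j) :
    stageValue N K β p τ R (m + 1) (insert i C) s ≤
      stageValue N K β p τ R (m + 1) (insert j C) s := by
  rcases eq_or_ne i j with rfl | hne
  · exact le_rfl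
  have hreward := le_reward_exchange hRsym hRinc hi hj hC hs hij
  have hsum := sum_powerset_weight_le (C := C) hp0 hp1
    (f := fun E => (1 - p) * W N K β p τ R m (sortVec N (stepVec τ E s)) +
      p * W N K β p τ R m (sortVec N (stepVec τ (insert i E) s)))
    (g := fun E => (1 - p) * W N K β p τ R m (sortVec N (stepVec τ E s)) +
      p * W N K β p τ R m (sortVec N (stepVec τ (insert j E) s)))
    (c := p * (L * (s j - s i))) (by
      intro E hE
      have hiE : i ∉ E := fun h => hi (hE h)
      have hjE : j ∉ E := fun h => hj (hE h)
      have hτij := hτ _ (hs j) _ (hs i) hij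
      have hstep : stepVec τ (insert i E) s j = τ (s j) := by simp [stepVec, hjE, hne.symm]
      have h1 := hlip (stepVec τ (insert i E) s) j (τ (s i)) (stepVec_mem hτmap _ hs)
        (hτmap _ (hs i)) (hstep ▸ hτij.1)
      rw [← stepVec_insert_comp_swap τ hne hiE hjE, sortVec_comp, hstep] at h1
      have h2 := h1.trans (mul_le_mul_of_nonneg_left hτij.2 hL0)
      have h3 := mul_le_mul_of_nonneg_left h2 hp0
      linarith)
  rw [stageValue, stageValue, sum_powerset_insert_weight hi hC, sum_powerset_insert_weight hj hC]
  have h4 := mul_le_mul_of_nonneg_left hsum hβ0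
  have h5 := mul_le_mul_of_nonneg_right hL (sub_nonneg.2 hij)
  rw [mul_sub] at h4
  linarith

/-- One-sided Lipschitz bound for scheduling a fixed set and continuing myopically. -/
theorem stageValue_succ_lipschitz {N K : ℕ} {β p : ℝ} (hβ0 : 0 ≤ β) (hp0 : 0 ≤ p) (hp1 : p ≤ 1)
    {τ : ℝ → ℝ} {R : (Fin K → ℝ) → ℝ} {Δl Δu L : ℝ}
    (hRinc : HasIncrementBounds R Δl Δu)
    (hτmap : ∀ x ∈ Set.Icc (0 : ℝ) 1, τ x ∈ Set.Icc (0 : ℝ) 1)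
    (hτ : ∀ x ∈ Set.Icc (0 : ℝ) 1, ∀ y ∈ Set.Icc (0 : ℝ) 1, y ≤ x →
      τ y ≤ τ x ∧ τ x - τ y ≤ x - y)
    (hL0 : 0 ≤ L) (hL : β * p * L ≤ Δu) {m : ℕ}
    (hlip : ∀ (s : Fin N → ℝ) (i : Fin N) (y : ℝ), (∀ i, s i ∈ Set.Icc (0 : ℝ) 1) →
      y ∈ Set.Icc (0 : ℝ) 1 → y ≤ s i → W N K β p τ R m (sortVec N s) -
        W N K β p τ R m (sortVec N (Function.update s i y)) ≤ L * (s i - y))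
    {s : Fin N → ℝ} (hs : ∀ i, s i ∈ Set.Icc (0 : ℝ) 1) {A : Finset (Fin N)} (hA : A.card = K)
    (i : Fin N) {y : ℝ} (hy : y ∈ Set.Icc (0 : ℝ) 1) (hys : y ≤ s i) :
    stageValue N K β p τ R (m + 1) A s -
      stageValue N K β p τ R (m + 1) A (Function.update s i y) ≤
        (Δu + β * (1 - p) * L) * (s i - y) := by
  have hτi := hτ _ (hs i) _ hy hys
  have hstep : ∀ E : Finset (Fin N), i ∉ E → W N K β p τ R m (sortVec N (stepVec τ E s)) -
      W N K β p τ R m (sortVec N (stepVec τ E (Function.update s i y))) ≤ L * (s i - y) := by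
    intro E hiE
    have he : stepVec τ E s i = τ (s i) := by simp [stepVec, hiE]
    have h1 := hlip (stepVec τ E s) i (τ y) (stepVec_mem hτmap _ hs) (hτmap _ hy) (he ▸ hτi.1)
    rw [← stepVec_update_of_notMem τ hiE, he] at h1
    exact h1.trans (mul_le_mul_of_nonneg_left hτi.2 hL0)
  rw [stageValue, stageValue]
  by_cases hi : i ∈ A
  · have hC : (A.erase i).card + 1 = K := by rw [Finset.card_erase_add_one hi, hA]
    have hreward := reward_update_le hRinc hA hs hi hy hys
    have hsum := sum_powerset_weight_le (C := A.erase i) hp0 hp1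
      (f := fun E => (1 - p) * W N K β p τ R m (sortVec N (stepVec τ E s)) +
        p * W N K β p τ R m (sortVec N (stepVec τ (insert i E) s)))
      (g := fun E => (1 - p) * W N K β p τ R m (sortVec N (stepVec τ E (Function.update s i y))) +
        p * W N K β p τ R m (sortVec N (stepVec τ (insert i E) (Function.update s i y))))
      (c := (1 - p) * (L * (s i - y))) (by
        intro E hE
        have h1 := hstep E fun h => Finset.notMem_erase i A (hE h)
        have h2 := mul_le_mul_of_nonneg_left h1 (sub_nonneg.2 hp1)
        simp only [stepVec_update_of_mem τ (Finset.mem_insert_self i E)]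
        linarith)
    have hni := Finset.notMem_erase i A
    have hs1 := sum_powerset_insert_weight hni hC p
      (fun E => W N K β p τ R m (sortVec N (stepVec τ E s)))
    have hs2 := sum_powerset_insert_weight hni hC p
      (fun E => W N K β p τ R m (sortVec N (stepVec τ E (Function.update s i y))))
    rw [Finset.insert_erase hi] at hs1 hs2
    rw [hs1, hs2]
    have h4 := mul_le_mul_of_nonneg_left hsum hβ0
    rw [mul_sub] at h4
    linarith
  · rw [restr_update_of_notMem hA s hi]
    have hsum := sum_powerset_weight_le (C := A) hp0 hp1
      (f := fun E => W N K β p τ R m (sortVec N (stepVec τ E s)))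
      (g := fun E => W N K β p τ R m (sortVec N (stepVec τ E (Function.update s i y))))
      (c := L * (s i - y)) (fun E hE => hstep E fun h => hi (hE h))
    rw [hA] at hsum
    have h4 := mul_le_mul_of_nonneg_left hsum hβ0
    have h5 := mul_le_mul_of_nonneg_right hL (sub_nonneg.2 hys)
    rw [mul_sub] at h4
    linarith

/-- With `m` slots remaining, no scheduled set beats the myopic one, and the myopic value function
has one-sided Lipschitz constant `lipConst β p Δu m` in each coordinate. -/
theorem stageValue_le_and_lipschitz {N K : ℕ} (hKN : K ≤ N) {β p : ℝ} (hβ0 : 0 ≤ β)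
    (hp0 : 0 ≤ p) (hp1 : p ≤ 1) {τ : ℝ → ℝ} {R : (Fin K → ℝ) → ℝ} {Δl Δu : ℝ}
    (hΔ : Δl ≤ Δu) (hΔl : 0 ≤ Δl)
    (hRsym : ∀ (σ : Equiv.Perm (Fin K)) (x : Fin K → ℝ), R (x ∘ σ) = R x)
    (hRinc : HasIncrementBounds R Δl Δu)
    (hτmap : ∀ x ∈ Set.Icc (0 : ℝ) 1, τ x ∈ Set.Icc (0 : ℝ) 1)
    (hτmono : ∀ x ∈ Set.Icc (0 : ℝ) 1, ∀ y ∈ Set.Icc (0 : ℝ) 1, y < x → τ y < τ x)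
    (hτcon : ∀ x ∈ Set.Icc (0 : ℝ) 1, ∀ y ∈ Set.Icc (0 : ℝ) 1, |τ x - τ y| ≤ |x - y|)
    {T : ℕ} (hcond : ∀ m ≤ T, β * p * lipConst β p Δu m ≤ Δl) {m : ℕ} (hm : m ≤ T) :
    (∀ s : Fin N → ℝ, (∀ i, s i ∈ Set.Icc (0 : ℝ) 1) → ∀ A : Finset (Fin N), A.card = K →
      stageValue N K β p τ R m A s ≤ W N K β p τ R m (sortVec N s)) ∧
    (∀ (s : Fin N → ℝ) (i : Fin N) (y : ℝ), (∀ i, s i ∈ Set.Icc (0 : ℝ) 1) →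
      y ∈ Set.Icc (0 : ℝ) 1 → y ≤ s i → W N K β p τ R m (sortVec N s) -
        W N K β p τ R m (sortVec N (Function.update s i y)) ≤
          lipConst β p Δu m * (s i - y)) := by
  have hτ : ∀ x ∈ Set.Icc (0 : ℝ) 1, ∀ y ∈ Set.Icc (0 : ℝ) 1, y ≤ x →
      τ y ≤ τ x ∧ τ x - τ y ≤ x - y := by
    intro x hx y hy hyx
    refine ⟨?_, ?_⟩
    · rcases hyx.eq_or_lt with rfl | h
      · exact le_rfl
      · exact (hτmono x hx y hy h).le
    · have h := hτcon x hx y hy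
      rw [abs_of_nonneg (sub_nonneg.2 hyx)] at h
      exact (le_abs_self _).trans h
  have hopt : ∀ m, (∀ s : Fin N → ℝ, (∀ i, s i ∈ Set.Icc (0 : ℝ) 1) →
      ∀ (C : Finset (Fin N)) (i j : Fin N), i ∉ C → j ∉ C → C.card + 1 = K → s i ≤ s j →
        stageValue N K β p τ R m (insert i C) s ≤ stageValue N K β p τ R m (insert j C) s) →
      ∀ s : Fin N → ℝ, (∀ i, s i ∈ Set.Icc (0 : ℝ) 1) → ∀ A : Finset (Fin N), A.card = K →
        stageValue N K β p τ R m A s ≤ W N K β p τ R m (sortVec N s) := by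
    intro m hex s hs A hA
    obtain ⟨B, hB, hW, htop⟩ := exists_W_eq_stageValue (β := β) (p := p) hKN hRsym hτmap hτmono m hs
    rw [hW]
    exact le_of_exchange s (fun A => stageValue N K β p τ R m A s) (hex s hs) hB htop hA
  have hLip : ∀ (m : ℕ) (L : ℝ), (∀ s : Fin N → ℝ, (∀ i, s i ∈ Set.Icc (0 : ℝ) 1) →
      ∀ A : Finset (Fin N), A.card = K →
        stageValue N K β p τ R m A s ≤ W N K β p τ R m (sortVec N s)) →
      (∀ s : Fin N → ℝ, (∀ i, s i ∈ Set.Icc (0 : ℝ) 1) → ∀ A : Finset (Fin N), A.card = K →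
        ∀ (i : Fin N) (y : ℝ), y ∈ Set.Icc (0 : ℝ) 1 → y ≤ s i →
          stageValue N K β p τ R m A s - stageValue N K β p τ R m A (Function.update s i y) ≤
            L * (s i - y)) →
      ∀ (s : Fin N → ℝ) (i : Fin N) (y : ℝ), (∀ i, s i ∈ Set.Icc (0 : ℝ) 1) →
        y ∈ Set.Icc (0 : ℝ) 1 → y ≤ s i → W N K β p τ R m (sortVec N s) -
          W N K β p τ R m (sortVec N (Function.update s i y)) ≤ L * (s i - y) := by
    intro m L hle hQ s i y hs hy hys
    obtain ⟨A, hA, hW, -⟩ := exists_W_eq_stageValue (β := β) (p := p) hKN hRsym hτmap hτmono m hs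
    have hu : ∀ k, Function.update s i y k ∈ Set.Icc (0 : ℝ) 1 := by
      intro k
      by_cases h : k = i
      · subst h; simpa using hy
      · simpa [Function.update_of_ne h] using hs k
    have h1 := hle _ hu A hA
    have h2 := hQ s hs A hA i y hy hys
    rw [hW]
    linarith
  induction m with
  | zero =>
    have h0 := hopt 0 fun s hs C i j hi hj hC hij => by
      have h1 := le_reward_exchange hRsym hRinc hi hj hC hs hij
      have h2 := mul_nonneg hΔl (sub_nonneg.2 hij)
      simp only [stageValue]
      linarith
    refine ⟨h0, hLip 0 _ h0 fun s hs A hA i y hy hys => ?_⟩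
    rw [lipConst_zero]
    simp only [stageValue]
    by_cases hi : i ∈ A
    · exact reward_update_le hRinc hA hs hi hy hys
    · rw [restr_update_of_notMem hA s hi, sub_self]
      exact mul_nonneg (hΔl.trans hΔ) (sub_nonneg.2 hys)
  | succ m ih =>
    obtain ⟨-, hlip⟩ := ih (by omega)
    have hL0 := lipConst_nonneg hβ0 hp1 (hΔl.trans hΔ) m
    have hL := hcond m (by omega)
    have h0 := hopt (m + 1) fun s hs C i j hi hj hC hij =>
      stageValue_succ_exchange hβ0 hp0 hp1 hRsym hRinc hτmap hτ hL0 hL hlip hs hi hj hC hij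
    refine ⟨h0, hLip (m + 1) _ h0 fun s hs A hA i y hy hys => ?_⟩
    rw [lipConst_succ]
    exact stageValue_succ_lipschitz hβ0 hp0 hp1 hRinc hτmap hτ hL0 (hL.trans hΔ) hlip hs hA i hy hys

/-- If the myopic choice is optimal at every stage, it is optimal among all policies. -/
theorem Vpol_le_W {N K T : ℕ} {β p : ℝ} (hβ0 : 0 ≤ β) (hp0 : 0 ≤ p) (hp1 : p ≤ 1)
    {τ : ℝ → ℝ} {R : (Fin K → ℝ) → ℝ}
    (hτmap : ∀ x ∈ Set.Icc (0 : ℝ) 1, τ x ∈ Set.Icc (0 : ℝ) 1)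
    (hopt : ∀ m ≤ T, ∀ s : Fin N → ℝ, (∀ i, s i ∈ Set.Icc (0 : ℝ) 1) →
      ∀ A : Finset (Fin N), A.card = K →
        stageValue N K β p τ R m A s ≤ W N K β p τ R m (sortVec N s))
    {pol : ℕ → (Fin N → ℝ) → Finset (Fin N)} (hpol : ∀ m s, (pol m s).card = K)
    {m : ℕ} (hm : m ≤ T) {s : Fin N → ℝ} (hs : ∀ i, s i ∈ Set.Icc (0 : ℝ) 1) :
    Vpol N K T β p τ R pol m s ≤ W N K β p τ R m (sortVec N s) := by
  induction m generalizing s with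
  | zero => exact hopt 0 hm s hs _ (hpol T s)
  | succ m ih =>
    refine le_trans ?_ (hopt (m + 1) hm s hs _ (hpol (T - (m + 1)) s))
    rw [Vpol, stageValue]
    refine add_le_add le_rfl (mul_le_mul_of_nonneg_left (Finset.sum_le_sum fun E _ => ?_) hβ0)
    exact mul_le_mul_of_nonneg_left (ih (by omega) (stepVec_mem hτmap E hs))
      (mul_nonneg (pow_nonneg (sub_nonneg.2 hp1) _) (pow_nonneg hp0 _))

/-- Theorem 1: if `R` is regular (symmetric, nondecreasing in each argument, decomposable)
and bounded with constants `Δl ≤ Δu`, `τ` is a monotonically increasing contracting map,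
`β ≤ 1`, and `Δl ≥ Δu·β·p·(1 - (β(1-p))^(T+1))/(1 - β(1-p))`, then the myopic policy is
optimal: for every scheduling policy, every time `1 ≤ n ≤ T` and every belief vector `s`,
`V^π_n(s) ≤ W_n(sort s)`. -/
theorem myopic_policy_optimal
    (N K T : ℕ) (hK : 1 ≤ K) (hKN : K ≤ N) (hT : 1 ≤ T)
    (β p : ℝ) (hβ0 : 0 < β) (hβ1 : β ≤ 1) (hp0 : 0 ≤ p) (hp1 : p ≤ 1)
    (τ : ℝ → ℝ) (R : (Fin K → ℝ) → ℝ)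
    (hRsym : ∀ (σ : Equiv.Perm (Fin K)) (x : Fin K → ℝ), R (x ∘ σ) = R x)
    (hRmono : ∀ (j : Fin K) (x : Fin K → ℝ), (∀ k, x k ∈ Set.Icc (0 : ℝ) 1) →
      ∀ a b : ℝ, a ∈ Set.Icc (0 : ℝ) 1 → b ∈ Set.Icc (0 : ℝ) 1 → a ≤ b →
        R (Function.update x j a) ≤ R (Function.update x j b))
    (hRdec : ∀ (j : Fin K) (x : Fin K → ℝ), (∀ k, x k ∈ Set.Icc (0 : ℝ) 1) →
      R x = x j * R (Function.update x j 1) + (1 - x j) * R (Function.update x j 0))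
    (Δl Δu : ℝ) (hΔ : Δl ≤ Δu)
    (hRbound : ∀ (j : Fin K) (x : Fin K → ℝ), (∀ k, x k ∈ Set.Icc (0 : ℝ) 1) →
      Δl ≤ R (Function.update x j 1) - R (Function.update x j 0) ∧
        R (Function.update x j 1) - R (Function.update x j 0) ≤ Δu)
    (hτmap : ∀ x ∈ Set.Icc (0 : ℝ) 1, τ x ∈ Set.Icc (0 : ℝ) 1)
    (hτmono : ∀ x ∈ Set.Icc (0 : ℝ) 1, ∀ y ∈ Set.Icc (0 : ℝ) 1, y < x → τ y < τ x)
    (hτcon : ∀ x ∈ Set.Icc (0 : ℝ) 1, ∀ y ∈ Set.Icc (0 : ℝ) 1, |τ x - τ y| ≤ |x - y|)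
    (hcond : Δu * β * p * ((1 - (β * (1 - p)) ^ (T + 1)) / (1 - β * (1 - p))) ≤ Δl) :
    ∀ pol : ℕ → (Fin N → ℝ) → Finset (Fin N),
      (∀ m s, (pol m s).card = K) →
      ∀ n : ℕ, 1 ≤ n → n ≤ T →
      ∀ s : Fin N → ℝ, (∀ i, s i ∈ Set.Icc (0 : ℝ) 1) →
        Vpol N K T β p τ R pol (T - n) s ≤ W N K β p τ R (T - n) (sortVec N s) := by
  intro pol hpol n _ _ s hs
  have hRinc := hasIncrementBounds_of_decomposable hRdec hRbound
  have hzero : ∀ _ : Fin K, (0 : ℝ) ∈ Set.Icc (0 : ℝ) 1 := fun _ => by simp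
  have hΔu : 0 ≤ Δu := by
    have h1 := hRmono ⟨0, hK⟩ (fun _ => 0) hzero 0 1 (by simp) (by simp) zero_le_one
    have h2 := (hRbound ⟨0, hK⟩ (fun _ => 0) hzero).2
    linarith
  have hlip : ∀ m ≤ T, β * p * lipConst β p Δu m ≤ Δl := fun m hm =>
    mul_lipConst_le hβ0 hβ1 hp0 hp1 hΔu hm hcond
  have hΔl : 0 ≤ Δl :=
    (mul_nonneg (mul_nonneg hβ0.le hp0) (lipConst_nonneg hβ0.le hp1 hΔu 0)).trans (hlip 0 T.zero_le)
  exact Vpol_le_W hβ0.le hp0 hp1 hτmap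
    (fun m hm => (stageValue_le_and_lipschitz hKN hβ0.le hp0 hp1 hΔ hΔl hRsym hRinc hτmap hτmono
      hτcon hlip hm).1) hpol (Nat.sub_le T n) hs
end

section
/- (Decomposability of the batteryless pseudo value function, equation (12).) For every 1 ≤ n ≤ T, every coordinate k ∈ {1,…,N}, and every v ∈ [0,1]^N, the pseudo value function satisfies W_n(v) = v_k·W_n(v with v_k replaced by 1) + (1 − v_k)·W_n(v with v_k replaced by 0); i.e., W_n is affine in each coordinate. Consequently, if Π is an i,j-swap of a permutation Π̂, then W_n(v_Π) − W_n(v_Π̂) = (v_{Π(j)} − v_{Π(i)})·(W_n(…, v_{Π(j)}=1, …, v_{Π(i)}=0, …) − W_n(…, v_{Π(j)}=0, …, v_{Π(i)}=1, …)). -/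
/-- The next belief vector `[P11(Σl), τ(v_Ē), P01(|E|-Σl)]` of the batteryless model:
`|H|` entries `p11` (the active coordinates `H ⊆ E` found harvesting), then
`τ(x) = (p11 - p01)·x + p01` applied entrywise to the coordinates of `v` outside the active
set `E` (kept in their original order), then `|E| - |H|` entries `p01`. -/
noncomputable def nextVec2 (N : ℕ) (p01 p11 : ℝ) (E H : Finset (Fin N)) (v : Fin N → ℝ) :
    Fin N → ℝ :=
  fun i => (List.replicate H.card p11 ++
      ((Finset.univ \ E).sort (· ≤ ·)).map (fun j => (p11 - p01) * v j + p01) ++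
      List.replicate (E.card - H.card) p01).getD i.val 0

/-- The pseudo value function of the batteryless model, indexed by remaining time:
`W2 … m v` is the pseudo value function `W_n(v)` of the paper with `m = T - n` slots
remaining after the current one; `W2 … 0 v = p·Σ_{i=1}^K v_i` and
`W2 … (m+1) v = p·Σ_{i=1}^K v_i + β·Σ_{E ⊆ {1,…,K}} Σ_{H ⊆ E}
  (1-p)^(K-|E|) p^|E| (Π_{j∈H} v_j)(Π_{j∈E∖H}(1-v_j)) · W2 … m ([P11(|H|), τ(v_Ē), P01(|E|-|H|)])`. -/
noncomputable def W2 (N K : ℕ) (β p p01 p11 : ℝ) : ℕ → (Fin N → ℝ) → ℝ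
  | 0, v => p * ∑ i ∈ sched N K, v i
  | m + 1, v => p * ∑ i ∈ sched N K, v i +
      β * ∑ E ∈ (sched N K).powerset, ∑ H ∈ E.powerset,
        ((1 - p) ^ (K - E.card) * p ^ E.card * (∏ j ∈ H, v j) * (∏ j ∈ E \ H, (1 - v j))) *
          W2 N K β p p01 p11 m (nextVec2 N p01 p11 E H v)

/-- A function of finitely many real coordinates is affine in each of them, expressed through
its values at the endpoints `0` and `1`. -/
def CoordAffine {ι : Type*} [DecidableEq ι] (F : (ι → ℝ) → ℝ) : Prop :=
  ∀ (v : ι → ℝ) (k : ι),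
    F v = v k * F (Function.update v k 1) + (1 - v k) * F (Function.update v k 0)

namespace CoordAffine

variable {ι : Type*} [DecidableEq ι] {F : (ι → ℝ) → ℝ}

lemma apply_update (hF : CoordAffine F) (v : ι → ℝ) (k : ι) (x : ℝ) :
    F (Function.update v k x) =
      x * F (Function.update v k 1) + (1 - x) * F (Function.update v k 0) := by
  simpa using hF (Function.update v k x) k

lemma sub_comp_swap (hF : CoordAffine F) (v : ι → ℝ) (i j : ι) :
    F v - F (v ∘ Equiv.swap i j) =
      (v i - v j) * (F (Function.update (Function.update v i 1) j 0) -
        F (Function.update (Function.update v i 0) j 1)) := by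
  rcases eq_or_ne i j with rfl | hij
  · simp
  have expand (x y : ℝ) : F (Function.update (Function.update v i x) j y) =
      x * (y * F (Function.update (Function.update v i 1) j 1) +
        (1 - y) * F (Function.update (Function.update v i 1) j 0)) +
      (1 - x) * (y * F (Function.update (Function.update v i 0) j 1) +
        (1 - y) * F (Function.update (Function.update v i 0) j 0)) := by
    rw [Function.update_comm hij, hF.apply_update _ i x]
    simp only [Function.update_comm hij.symm]
    rw [hF.apply_update _ j y, hF.apply_update (Function.update v i 0) j y]
  have hswap : v ∘ Equiv.swap i j = Function.update (Function.update v i (v j)) j (v i) := by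
    ext l
    simp only [Function.comp_apply, Equiv.swap_apply_def, Function.update_apply]
    grind
  have hid : v = Function.update (Function.update v i (v i)) j (v j) := by simp
  have hv : F v = F (Function.update (Function.update v i (v i)) j (v j)) := congrArg F hid
  rw [hv, hswap, expand (v i) (v j), expand (v j) (v i)]
  ring

lemma sum (s : Finset ι) : CoordAffine fun v : ι → ℝ => ∑ i ∈ s, v i := by
  intro v k
  dsimp only
  rw [Finset.mul_sum, Finset.mul_sum, ← Finset.sum_add_distrib]
  refine Finset.sum_congr rfl fun i _ => ?_
  rcases eq_or_ne i k with rfl | h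
  · simp
  · simp only [Function.update_of_ne h]
    ring

lemma finset_sum {κ : Type*} (s : Finset κ) {G : κ → (ι → ℝ) → ℝ}
    (hG : ∀ a ∈ s, CoordAffine (G a)) : CoordAffine fun v => ∑ a ∈ s, G a v := by
  intro v k
  dsimp only
  rw [Finset.mul_sum, Finset.mul_sum, ← Finset.sum_add_distrib]
  exact Finset.sum_congr rfl fun a ha => hG a ha v k

lemma add {G : (ι → ℝ) → ℝ} (hF : CoordAffine F) (hG : CoordAffine G) :
    CoordAffine fun v => F v + G v := by
  intro v k
  linear_combination hF v k + hG v k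

lemma const_mul (c : ℝ) (hF : CoordAffine F) : CoordAffine fun v => c * F v := by
  intro v k
  linear_combination c * hF v k

end CoordAffine

lemma prod_update_of_notMem {ι : Type*} [DecidableEq ι] {s : Finset ι} {k : ι} (hk : k ∉ s)
    (f : ℝ → ℝ) (v : ι → ℝ) (x : ℝ) :
    ∏ j ∈ s, f (Function.update v k x j) = ∏ j ∈ s, f (v j) :=
  Finset.prod_congr rfl fun j hj => by
    rw [Function.update_of_ne (ne_of_mem_of_not_mem hj hk)]

/-- The likelihood of an observation `H ⊆ E` is affine in each coordinate. -/
lemma coordAffine_prod_mul_prod {ι : Type*} [DecidableEq ι] {E H : Finset ι} (hHE : H ⊆ E) :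
    CoordAffine fun v : ι → ℝ => (∏ j ∈ H, v j) * ∏ j ∈ E \ H, (1 - v j) := by
  intro v k
  have hH := fun hk : k ∉ H => prod_update_of_notMem hk id v
  have hE := fun hk : k ∉ E \ H => prod_update_of_notMem hk (fun y => 1 - y) v
  simp only [id] at hH hE
  by_cases hkH : k ∈ H
  · have hkE : k ∉ E \ H := by simp [hkH]
    simp only [hE hkE, ← Finset.mul_prod_erase H _ hkH, Function.update_self]
    have := prod_update_of_notMem (Finset.notMem_erase k H) id v
    simp only [id] at this
    rw [this, this]
    ring
  · by_cases hkE : k ∈ E \ H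
    · simp only [hH hkH, ← Finset.mul_prod_erase (E \ H) _ hkE, Function.update_self]
      have := prod_update_of_notMem (Finset.notMem_erase k (E \ H)) (fun y => 1 - y) v
      rw [this, this]
      ring
    · simp only [hH hkH, hE hkE]
      ring

lemma nextVec2_update_of_mem {N : ℕ} (p01 p11 : ℝ) {E : Finset (Fin N)} (H : Finset (Fin N))
    {k : Fin N} (hk : k ∈ E) (v : Fin N → ℝ) (x : ℝ) :
    nextVec2 N p01 p11 E H (Function.update v k x) = nextVec2 N p01 p11 E H v := by
  have : ((Finset.univ \ E).sort (· ≤ ·)).map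
        (fun j => (p11 - p01) * Function.update v k x j + p01) =
      ((Finset.univ \ E).sort (· ≤ ·)).map (fun j => (p11 - p01) * v j + p01) := by
    refine List.map_congr_left fun j hj => ?_
    rw [Function.update_of_ne]
    rintro rfl
    simp_all
  unfold nextVec2
  rw [this]

/-- An inactive coordinate `k` feeds exactly one coordinate of the next belief vector. -/
lemma exists_nextVec2_update {N : ℕ} (p01 p11 : ℝ) {E H : Finset (Fin N)} (hHE : H ⊆ E)
    {k : Fin N} (hk : k ∉ E) (v : Fin N → ℝ) :
    ∃ l : Fin N, ∀ x : ℝ, nextVec2 N p01 p11 E H (Function.update v k x) =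
      Function.update (nextVec2 N p01 p11 E H v) l ((p11 - p01) * x + p01) := by
  have hmem : k ∈ (Finset.univ \ E).sort (· ≤ ·) := by simp [hk]
  have hnodup : ((Finset.univ \ E).sort (· ≤ ·)).Nodup := Finset.sort_nodup _ _
  have hlen : ((Finset.univ \ E).sort (· ≤ ·)).length + E.card = N := by
    rw [Finset.length_sort, Finset.card_sdiff_add_card_eq_card (Finset.subset_univ E)]
    simp
  unfold nextVec2
  generalize (Finset.univ \ E).sort (· ≤ ·) = L at hmem hnodup hlen
  obtain ⟨m, hm, rfl⟩ := List.getElem_of_mem hmem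
  have hcard := Finset.card_le_card hHE
  refine ⟨⟨H.card + m, by omega⟩, fun x => ?_⟩
  have hmap : L.map (fun j => (p11 - p01) * Function.update v L[m] x j + p01) =
      (L.map fun j => (p11 - p01) * v j + p01).set m ((p11 - p01) * x + p01) := by
    refine List.ext_getElem (by simp) fun a ha _ => ?_
    simp only [List.getElem_map, List.getElem_set, Function.update_apply,
      hnodup.getElem_inj_iff, eq_comm (a := m)]
    split_ifs <;> rfl
  ext i
  rw [hmap, Function.update_apply]
  simp only [Fin.ext_iff, List.getD_eq_getElem?_getD, List.getElem?_append, List.getElem?_set,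
    List.length_append, List.length_replicate, List.length_set, List.length_map]
  grind

lemma CoordAffine.comp_nextVec2 {N : ℕ} {F : (Fin N → ℝ) → ℝ} (hF : CoordAffine F)
    (p01 p11 : ℝ) {E H : Finset (Fin N)} (hHE : H ⊆ E) {k : Fin N} (hk : k ∉ E)
    (v : Fin N → ℝ) :
    F (nextVec2 N p01 p11 E H v) =
      v k * F (nextVec2 N p01 p11 E H (Function.update v k 1)) +
        (1 - v k) * F (nextVec2 N p01 p11 E H (Function.update v k 0)) := by
  obtain ⟨l, hl⟩ := exists_nextVec2_update p01 p11 hHE hk v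
  have hv := hl (v k)
  rw [Function.update_eq_self] at hv
  have hv' := (congrArg F hv).trans (hF.apply_update _ l _)
  rw [hv', hl, hl, hF.apply_update _ l (_ * 1 + _), hF.apply_update _ l (_ * 0 + _)]
  ring

lemma coordAffine_W2 (N K : ℕ) (β p p01 p11 : ℝ) (m : ℕ) :
    CoordAffine (W2 N K β p p01 p11 m) := by
  induction m with
  | zero => exact (CoordAffine.sum (sched N K)).const_mul p
  | succ m ih =>
    refine ((CoordAffine.sum (sched N K)).const_mul p).add (CoordAffine.const_mul β
      (.finset_sum _ fun E _ => .finset_sum _ fun H hH => ?_))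
    have hHE := Finset.mem_powerset.mp hH
    intro v k
    by_cases hk : k ∈ E
    · simp only [nextVec2_update_of_mem p01 p11 H hk]
      linear_combination ((1 - p) ^ (K - E.card) * p ^ E.card *
        W2 N K β p p01 p11 m (nextVec2 N p01 p11 E H v)) * coordAffine_prod_mul_prod hHE v k
    · have hprod := prod_update_of_notMem (fun h => hk (hHE h)) id v
      have hprod' := prod_update_of_notMem (s := E \ H)
        (fun h => hk (Finset.sdiff_subset h)) (fun y => 1 - y) v
      simp only [id] at hprod hprod'
      simp only [hprod, hprod']
      rw [ih.comp_nextVec2 p01 p11 hHE hk v]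
      ring

/-- Equation (12): the batteryless pseudo value function is affine (decomposable) in each
coordinate: `W_n(v) = v_k·W_n(v[k:=1]) + (1-v_k)·W_n(v[k:=0])`.  Consequently, for a swap
of coordinates `i, j`,
`W_n(v) - W_n(v∘(i j)) = (v_i - v_j)·(W_n(v[i:=1][j:=0]) - W_n(v[i:=0][j:=1]))`. -/
theorem batteryless_pseudo_value_decomposable
    (N K T : ℕ) (hK : 1 ≤ K) (hKN : K ≤ N) (hT : 1 ≤ T)
    (β p p01 p11 : ℝ) (hβ0 : 0 < β) (hβ1 : β ≤ 1) (hp0 : 0 ≤ p) (hp1 : p ≤ 1)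
    (hp010 : 0 ≤ p01) (hp0111 : p01 ≤ p11) (hp111 : p11 ≤ 1)
    (n : ℕ) (hn1 : 1 ≤ n) (hnT : n ≤ T)
    (v : Fin N → ℝ) (hv : ∀ i, v i ∈ Set.Icc (0 : ℝ) 1) :
    (∀ k : Fin N,
      W2 N K β p p01 p11 (T - n) v =
        v k * W2 N K β p p01 p11 (T - n) (Function.update v k 1) +
          (1 - v k) * W2 N K β p p01 p11 (T - n) (Function.update v k 0)) ∧
    (∀ i j : Fin N,
      W2 N K β p p01 p11 (T - n) v - W2 N K β p p01 p11 (T - n) (v ∘ Equiv.swap i j) =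
        (v i - v j) *
          (W2 N K β p p01 p11 (T - n) (Function.update (Function.update v i 1) j 0) -
            W2 N K β p p01 p11 (T - n) (Function.update (Function.update v i 0) j 1))) := by
  exact ⟨coordAffine_W2 N K β p p01 p11 (T - n) v,
    (coordAffine_W2 N K β p p01 p11 (T - n)).sub_comp_swap v⟩
end

section
/- (Symmetry of the batteryless pseudo value function in the scheduled coordinates.) For every 1 ≤ n ≤ T, every v ∈ [0,1]^N, and every pair of indices i, j ≤ K, the pseudo value function of the batteryless model satisfies W_n(v) = W_n(v ∘ (i j)), where v ∘ (i j) is v with coordinates i and j transposed. -/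
theorem map_sched_of_swap {N K : ℕ} {i j : Fin N} (hi : i.val < K) (hj : j.val < K) :
    (sched N K).map (Equiv.swap i j).toEmbedding = sched N K := by
  apply Finset.map_perm
  intro a ha
  by_contra h
  apply ha
  apply Equiv.swap_apply_of_ne_of_ne
  · rintro rfl
    simp [sched, hi] at h
  · rintro rfl
    simp [sched, hj] at h

theorem card_sched_le (N K : ℕ) : (sched N K).card ≤ K := by
  have h : ((sched N K).map Fin.valEmbedding) ⊆ Finset.range K := by
    intro x hx
    simp only [sched, Finset.mem_map, Finset.mem_filter] at hx
    obtain ⟨a, ha, rfl⟩ := hx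
    simpa using ha.2
  simpa using Finset.card_le_card h

/-- A function of a vector that is invariant under transpositions of the first `K` coordinates
is invariant under permutations of a block of entries lying in the first `K` positions. -/
theorem apply_getD_eq_of_perm {N K : ℕ} (hKN : K ≤ N) {F : (Fin N → ℝ) → ℝ}
    (hF : ∀ i j : Fin N, i.val < K → j.val < K → ∀ v, F v = F (v ∘ Equiv.swap i j))
    {l₁ l₂ : List ℝ} (h : l₁.Perm l₂) (c r : List ℝ) (hc : c.length + l₁.length ≤ K) :
    F (fun k => (c ++ l₁ ++ r).getD k.val 0) = F (fun k => (c ++ l₂ ++ r).getD k.val 0) := by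
  induction h generalizing c with
  | nil => rfl
  | cons x _ ih =>
    have := ih (c ++ [x]) (by simp at hc ⊢; omega)
    simpa using this
  | swap x y l =>
    simp only [List.length_cons] at hc
    have h0 : c.length < N := by omega
    have h1 : c.length + 1 < N := by omega
    rw [hF ⟨c.length, h0⟩ ⟨c.length + 1, h1⟩ (by simp; omega) (by simp; omega)]
    congr 1
    funext k
    simp only [Function.comp_apply, Equiv.swap_apply_def, Fin.ext_iff]
    split_ifs with e1 e2
    · simp [e1]
    · simp [e2]
    · by_cases hk : k.val < c.length
      · simp [List.getElem?_append, hk]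
      · obtain ⟨d, hd⟩ : ∃ d, k.val = c.length + (d + 2) := ⟨k.val - c.length - 2, by omega⟩
        simp [hd, List.getElem?_append]
  | trans h₁ _ ih₁ ih₂ => exact (ih₁ c hc).trans (ih₂ c (by rw [← h₁.length_eq]; exact hc))

theorem sort_compl_eq_append {N K : ℕ} {E : Finset (Fin N)} (hE : E ⊆ sched N K) :
    (Finset.univ \ E).sort (· ≤ ·) =
      (sched N K \ E).sort (· ≤ ·) ++ (Finset.univ \ sched N K).sort (· ≤ ·) := by
  have hlt : ∀ a ∈ (sched N K \ E).sort (· ≤ ·),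
      ∀ b ∈ (Finset.univ \ sched N K).sort (· ≤ ·), a < b := by
    intro a ha b hb
    simp only [sched, Finset.mem_sort, Finset.mem_sdiff, Finset.mem_filter, Finset.mem_univ,
      true_and] at ha hb
    rw [Fin.lt_def]
    omega
  refine List.Perm.eq_of_pairwise' (r := (· ≤ ·)) (Finset.pairwise_sort _ _)
    (List.pairwise_append.2 ⟨Finset.pairwise_sort _ _, Finset.pairwise_sort _ _,
      fun a ha b hb => (hlt a ha b hb).le⟩) ?_
  rw [List.perm_ext_iff_of_nodup (Finset.sort_nodup _ _)
    (List.nodup_append.2 ⟨Finset.sort_nodup _ _, Finset.sort_nodup _ _,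
      fun a ha b hb => (hlt a ha b hb).ne⟩)]
  intro a
  have := @hE a
  simp only [Finset.mem_sort, Finset.mem_sdiff, Finset.mem_univ, true_and, List.mem_append]
  tauto

theorem apply_nextVec2_map_swap {N K : ℕ} (hKN : K ≤ N) {F : (Fin N → ℝ) → ℝ}
    (hF : ∀ i j : Fin N, i.val < K → j.val < K → ∀ v, F v = F (v ∘ Equiv.swap i j))
    (p01 p11 : ℝ) {i j : Fin N} (hi : i.val < K) (hj : j.val < K) {E H : Finset (Fin N)}
    (hE : E ⊆ sched N K) (hH : H ⊆ E) (v : Fin N → ℝ) :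
    F (nextVec2 N p01 p11 E H (v ∘ Equiv.swap i j)) =
      F (nextVec2 N p01 p11 (E.map (Equiv.swap i j).toEmbedding)
        (H.map (Equiv.swap i j).toEmbedding) v) := by
  have hσ := map_sched_of_swap hi hj
  have hE' : E.map (Equiv.swap i j).toEmbedding ⊆ sched N K := by
    rw [← hσ]
    exact Finset.map_subset_map.2 hE
  unfold nextVec2
  rw [sort_compl_eq_append hE, sort_compl_eq_append hE']
  have htail : ((Finset.univ \ sched N K).sort (· ≤ ·)).map
        (fun k => (p11 - p01) * (v ∘ Equiv.swap i j) k + p01) =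
      ((Finset.univ \ sched N K).sort (· ≤ ·)).map (fun k => (p11 - p01) * v k + p01) := by
    apply List.map_congr_left
    intro a ha
    have hne : a ≠ i ∧ a ≠ j := by
      constructor <;> rintro rfl <;> simp [sched] at ha <;> omega
    simp [Equiv.swap_apply_of_ne_of_ne hne.1 hne.2]
  have hperm : (((sched N K \ E).sort (· ≤ ·)).map (Equiv.swap i j)).Perm
      ((sched N K \ E.map (Equiv.swap i j).toEmbedding).sort (· ≤ ·)) := by
    rw [List.perm_ext_iff_of_nodup
      ((Finset.sort_nodup _ _).map (Equiv.injective _)) (Finset.sort_nodup _ _)]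
    intro a
    conv_rhs => rw [← hσ]
    simp only [List.mem_map, Finset.mem_sort, Finset.mem_sdiff, Finset.mem_map_equiv]
    constructor
    · rintro ⟨b, hb, rfl⟩
      simpa using hb
    · intro h
      exact ⟨(Equiv.swap i j).symm a, h, Equiv.apply_symm_apply _ _⟩
  have hlen : (List.replicate H.card p11).length + (((sched N K \ E).sort (· ≤ ·)).map
      (fun k => (p11 - p01) * (v ∘ Equiv.swap i j) k + p01)).length ≤ K := by
    have h1 := card_sched_le N K
    have h2 := Finset.card_le_card hH
    have h3 := Finset.card_le_card hE
    simp only [List.length_replicate, List.length_map, Finset.length_sort,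
      Finset.card_sdiff_of_subset hE]
    omega
  have hperm' : (((sched N K \ E).sort (· ≤ ·)).map
      (fun k => (p11 - p01) * (v ∘ Equiv.swap i j) k + p01)).Perm
      (((sched N K \ E.map (Equiv.swap i j).toEmbedding).sort (· ≤ ·)).map
        (fun k => (p11 - p01) * v k + p01)) := by
    simpa only [List.map_map, Function.comp_def] using
      hperm.map (fun k => (p11 - p01) * v k + p01)
  simpa only [List.map_append, htail, Finset.card_map, List.append_assoc] using
    apply_getD_eq_of_perm hKN hF hperm' (List.replicate H.card p11)
      (((Finset.univ \ sched N K).sort (· ≤ ·)).map (fun k => (p11 - p01) * v k + p01) ++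
        List.replicate (E.card - H.card) p01) hlen

theorem sum_sched_comp_swap {N K : ℕ} {i j : Fin N} (hi : i.val < K) (hj : j.val < K)
    (v : Fin N → ℝ) :
    ∑ k ∈ sched N K, (v ∘ Equiv.swap i j) k = ∑ k ∈ sched N K, v k := by
  conv_rhs => rw [← map_sched_of_swap hi hj]
  simp

theorem W2_comp_swap {N K : ℕ} (hKN : K ≤ N) (β p p01 p11 : ℝ) (m : ℕ) :
    ∀ i j : Fin N, i.val < K → j.val < K → ∀ v,
      W2 N K β p p01 p11 m v = W2 N K β p p01 p11 m (v ∘ Equiv.swap i j) := by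
  induction m with
  | zero =>
    intro i j hi hj v
    simp only [W2, sum_sched_comp_swap hi hj]
  | succ m ih =>
    intro i j hi hj v
    have hσ := map_sched_of_swap hi hj
    simp only [W2, sum_sched_comp_swap hi hj]
    congr 2
    symm
    refine Finset.sum_equiv (Equiv.swap i j).finsetCongr (fun E => ?_) (fun E hE => ?_)
    · conv_rhs => rw [← hσ]
      simp [Finset.map_subset_map]
    refine Finset.sum_equiv (Equiv.swap i j).finsetCongr (fun H => ?_) (fun H hH => ?_)
    · simp [Finset.map_subset_map]
    rw [Finset.mem_powerset] at hE hH
    rw [apply_nextVec2_map_swap hKN ih p01 p11 hi hj hE hH v]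
    simp only [Equiv.finsetCongr_apply, Finset.card_map, ← Finset.map_sdiff, Finset.prod_map,
      Function.comp_apply, Equiv.coe_toEmbedding]

/-- Symmetry of the batteryless pseudo value function in the scheduled coordinates: for any
pair of scheduled indices `i, j ≤ K`, `W_n(v) = W_n(v ∘ (i j))`. -/
theorem batteryless_pseudo_value_symmetric_scheduled
    (N K T : ℕ) (hK : 1 ≤ K) (hKN : K ≤ N) (hT : 1 ≤ T)
    (β p p01 p11 : ℝ) (hβ0 : 0 < β) (hβ1 : β ≤ 1) (hp0 : 0 ≤ p) (hp1 : p ≤ 1)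
    (hp010 : 0 ≤ p01) (hp0111 : p01 ≤ p11) (hp111 : p11 ≤ 1)
    (n : ℕ) (hn1 : 1 ≤ n) (hnT : n ≤ T)
    (v : Fin N → ℝ) (hv : ∀ i, v i ∈ Set.Icc (0 : ℝ) 1)
    (i j : Fin N) (hi : i.val < K) (hj : j.val < K) :
    W2 N K β p p01 p11 (T - n) v = W2 N K β p p01 p11 (T - n) (v ∘ Equiv.swap i j) := by
  exact W2_comp_swap hKN β p p01 p11 (T - n) i j hi hj v
end
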